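/- The map g : B → 𝒥̄^Λ defined by g(w) = the block-diagonal d×d matrix whose j-th diagonal block (of size |S_j|, occupying rows and columns Σ_{k<j}|S_k|+1, …, Σ_{k≤j}|S_k|) is f(λ|_{S_j}, v^{(j)}(w)), where (S_1,…,S_r) is the ordered partition determined by w as above and v^{(j)}(w)_n = w^{K_j}_n / Σ_{m∈S_j} w^{K_j}_m for n ∈ S_j, is a bijection from B onto 𝒥̄^Λ which is a homeomorphism for the subspace topologies. -/

import Mathlib

noncomputable section
open Polynomial Filter Topology ENNReal

/-- The inner product `⟨p,q⟩_v = ∑ₖ p(μₖ)q(μₖ)vₖ`. -/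
def ip {m : ℕ} (μ v : Fin m → ℝ) (p q : ℝ[X]) : ℝ :=
  ∑ k, p.eval (μ k) * q.eval (μ k) * v k

/-- Pair `(pₙ, pₙ₋₁)` of monic orthogonal polynomials (with `p₋₁ = 0`). -/
def opAux {m : ℕ} (μ v : Fin m → ℝ) : ℕ → ℝ[X] × ℝ[X]
  | 0 => (1, 0)
  | n + 1 =>
    let P := opAux μ v n
    ((X - C (ip μ v P.1 (X * P.1) / ip μ v P.1 P.1)) * P.1
        - C (ip μ v P.1 P.1 / ip μ v P.2 P.2) * P.2, P.1)

/-- The `n`-th monic orthogonal polynomial of the recursion. -/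
def op {m : ℕ} (μ v : Fin m → ℝ) (n : ℕ) : ℝ[X] := (opAux μ v n).1

/-- The entry `a_N` of the Jacobi matrix construction: for odd `N = 2n+1` the diagonal
entry `a_{2n+1} = ⟨pₙ, Xpₙ⟩/⟨pₙ,pₙ⟩`, for even `N = 2n` the off-diagonal entry
`a_{2n} = √(⟨pₙ,pₙ⟩/⟨pₙ₋₁,pₙ₋₁⟩)`. -/
def fEnt {m : ℕ} (μ v : Fin m → ℝ) (N : ℕ) : ℝ :=
  if N % 2 = 1 then
    ip μ v (op μ v (N / 2)) (X * op μ v (N / 2)) / ip μ v (op μ v (N / 2)) (op μ v (N / 2))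
  else
    Real.sqrt (ip μ v (op μ v (N / 2)) (op μ v (N / 2)) /
      ip μ v (op μ v (N / 2 - 1)) (op μ v (N / 2 - 1)))

/-- The symmetric tridiagonal matrix `f(μ, v)` with diagonal `a₁,a₃,…` and
sub/super-diagonal `a₂,a₄,…`. -/
def Jmat {m : ℕ} (μ v : Fin m → ℝ) : Matrix (Fin m) (Fin m) ℝ :=
  Matrix.of fun i j =>
    if i = j then fEnt μ v (2 * (i : ℕ) + 1)
    else if (i : ℕ) + 1 = (j : ℕ) ∨ (j : ℕ) + 1 = (i : ℕ) then fEnt μ v ((i : ℕ) + (j : ℕ) + 1)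
    else 0

/-- Restriction of `g : Fin d → ℝ` to a subset `Q`, reindexed in increasing order. -/
def restr {d : ℕ} (Q : Finset (Fin d)) (g : Fin d → ℝ) : Fin Q.card → ℝ :=
  fun k => g ((Q.orderIsoOfFin rfl) k).1

/-- Leading `i × i` principal submatrix. -/
def leadSub {d : ℕ} (J : Matrix (Fin d) (Fin d) ℝ) (i : ℕ) (h : i ≤ d) :
    Matrix (Fin i) (Fin i) ℝ :=
  Matrix.of fun a b => J ⟨a.1, lt_of_lt_of_le a.2 h⟩ ⟨b.1, lt_of_lt_of_le b.2 h⟩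

/-- A sequence of positive weight vectors is stable if all pairwise ratios converge
in `[0,∞]`. -/
def Stable {d : ℕ} (w : ℕ → Fin d → ℝ) : Prop :=
  (∀ n i, 0 < w n i) ∧
    ∀ i j : Fin d, ∃ L : ℝ≥0∞,
      Tendsto (fun n => ENNReal.ofReal (w n i / w n j)) atTop (𝓝 L)

/-- `S : Fin r → Finset (Fin d)` is an ordered partition of `{0,…,d-1}`. -/
def OrdPart {d r : ℕ} (S : Fin r → Finset (Fin d)) : Prop :=
  (∀ j, (S j).Nonempty) ∧ (∀ j k, j ≠ k → Disjoint (S j) (S k)) ∧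
    Finset.univ.biUnion S = (Finset.univ : Finset (Fin d))

/-- `S` is the limiting partition of the stable sequence `w`. -/
def LimPart {d r : ℕ} (w : ℕ → Fin d → ℝ) (S : Fin r → Finset (Fin d)) : Prop :=
  OrdPart S ∧
  (∀ i j : Fin d, (∃ a, i ∈ S a ∧ j ∈ S a) ↔
      ∃ L : ℝ, 0 < L ∧ Tendsto (fun n => w n i / w n j) atTop (𝓝 L)) ∧
  (∀ a b : Fin r, a < b → ∀ i ∈ S a, ∀ j ∈ S b,
      Tendsto (fun n => w n i / w n j) atTop atTop)

/-- The constant `C_i^T = ∏_{t ∈ T} (λ_t − λ_i)²`. -/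
def Cc {d : ℕ} (lam : Fin d → ℝ) (i : Fin d) (T : Finset (Fin d)) : ℝ :=
  ∏ t ∈ T, (lam t - lam i) ^ 2

/-- Offset `∑_{k<j} |S_k|` of the `j`-th block. -/
def offS {d r : ℕ} (S : Fin r → Finset (Fin d)) (j : Fin r) : ℕ :=
  ∑ k ∈ Finset.univ.filter (· < j), (S k).card

/-- The block-diagonal matrix whose `j`-th block (in rows/columns
`offS S j, …, offS S j + |S_j| - 1`) is `Jmat (restr (S j) lam) (restr (S j) (v j))`. -/
def blockDiag {d r : ℕ} (lam : Fin d → ℝ) (S : Fin r → Finset (Fin d))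
    (v : Fin r → Fin d → ℝ) : Matrix (Fin d) (Fin d) ℝ :=
  Matrix.of fun p q =>
    ∑ j : Fin r,
      if h : offS S j ≤ (p : ℕ) ∧ (p : ℕ) < offS S j + (S j).card ∧
          offS S j ≤ (q : ℕ) ∧ (q : ℕ) < offS S j + (S j).card then
        Jmat (restr (S j) lam) (restr (S j) (v j))
          ⟨(p : ℕ) - offS S j, by omega⟩ ⟨(q : ℕ) - offS S j, by omega⟩
      else 0

/-- Nonempty subsets of `Fin d`. -/
abbrev NES (d : ℕ) := {S : Finset (Fin d) // S.Nonempty}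

/-- The ambient Euclidean space of families `(w^S)` indexed by nonempty subsets. -/
abbrev Ew (d : ℕ) := NES d → Fin d → ℝ

/-- The blow-up `B` (normalized representatives): support, nonnegativity,
normalization, and the quadratic equations. -/
def Bset {d : ℕ} (lam : Fin d → ℝ) : Set (Ew d) :=
  {w | (∀ S : NES d, ∀ n, n ∉ S.1 → w S n = 0) ∧
    (∀ S n, 0 ≤ w S n) ∧
    (∀ S : NES d, ∑ n ∈ S.1, w S n = 1) ∧
    ∀ R S : NES d, R.1 ⊆ S.1 → ∀ i ∈ R.1, ∀ j ∈ R.1,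
      Cc lam i (S.1 \ R.1) * w R j * w S i = Cc lam j (S.1 \ R.1) * w R i * w S j}

/-- `𝒥̄^Λ`: symmetric tridiagonal matrices with nonnegative off-diagonal entries and
characteristic polynomial `∏ (X − λ_k)`. -/
def Jset {d : ℕ} (lam : Fin d → ℝ) : Set (Matrix (Fin d) (Fin d) ℝ) :=
  {J | (∀ i j, J i j = J j i) ∧
    (∀ i j : Fin d, (i : ℕ) + 2 ≤ (j : ℕ) ∨ (j : ℕ) + 2 ≤ (i : ℕ) → J i j = 0) ∧
    (∀ i j : Fin d, (i : ℕ) + 1 = (j : ℕ) → 0 ≤ J i j) ∧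
    J.charpoly = ∏ k, (X - C (lam k))}

/-- `K_j = S_j ∪ S_{j+1} ∪ … ∪ S_r`. -/
def Kof {d r : ℕ} (S : Fin r → Finset (Fin d)) (j : Fin r) : Finset (Fin d) :=
  (Finset.univ.filter (j ≤ ·)).biUnion S

/-- The piece `Z(P)` of `B` corresponding to the ordered partition `P = (S_1,…,S_r)`:
for every nonempty `T`, the support of `w^T` is `T ∩ S_{i(T,P)}`. -/
def Zset {d : ℕ} (lam : Fin d → ℝ) {r : ℕ} (S : Fin r → Finset (Fin d)) : Set (Ew d) :=
  {w | w ∈ Bset lam ∧ ∀ T : NES d, ∃ j : Fin r, T.1 ⊆ Kof S j ∧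
    (∀ k, T.1 ⊆ Kof S k → k ≤ j) ∧ ∀ n : Fin d, w T n ≠ 0 ↔ n ∈ T.1 ∧ n ∈ S j}

/-- `R ⪯ S`: the ordered partition `R` refines `S`, i.e. `R` is the concatenation of
ordered partitions of `S_1`, then `S_2`, etc. -/
def Refines {d q r : ℕ} (R : Fin q → Finset (Fin d)) (S : Fin r → Finset (Fin d)) : Prop :=
  ∃ b : Fin (r + 1) → ℕ, b 0 = 0 ∧ b (Fin.last r) = q ∧
    (∀ i j : Fin (r + 1), i ≤ j → b i ≤ b j) ∧
    ∀ i : Fin r, S i = (Finset.univ.filter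
      (fun k : Fin q => b i.castSucc ≤ (k : ℕ) ∧ (k : ℕ) < b i.succ)).biUnion R

/-- The `j`-th consecutive interval `I_j(T)` of lengths `|T_1|,…,|T_r|`. -/
def Iint {d r : ℕ} (T : Fin r → Finset (Fin d)) (j : Fin r) : Finset (Fin d) :=
  Finset.univ.filter (fun m : Fin d => offS T j ≤ (m : ℕ) ∧ (m : ℕ) < offS T j + (T j).card)

/-- `H(T) = {σ : σ(T_j) = I_j(T) for all j}`. -/
def Hset {d r : ℕ} (T : Fin r → Finset (Fin d)) : Set (Equiv.Perm (Fin d)) :=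
  {σ | ∀ j, (T j).image σ = Iint T j}

/-- Interval Young subgroups: setwise stabilizers of a division of `{0,…,d-1}` into
consecutive intervals. -/
def IsIntervalYoung {d : ℕ} (G : Set (Equiv.Perm (Fin d))) : Prop :=
  ∃ (q : ℕ) (c : Fin q → Finset (Fin d)), OrdPart c ∧ (∀ j : Fin q, c j = Iint c j) ∧
    G = {τ : Equiv.Perm (Fin d) | ∀ j, (c j).image ⇑τ = c j}

/-- Number of surjections from an `a`-element set onto a `b`-element set. -/
def Surj (a b : ℕ) : ℕ := Fintype.card {f : Fin a → Fin b // Function.Surjective f}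

/-- The Euler characteristic `χ_d = ∑_{q=1}^d (−2)^{d−q}·Surj(d,q)`. -/
def chi (a : ℕ) : ℝ := ∑ q ∈ Finset.Icc 1 a, (-2 : ℝ) ^ (a - q) * (Surj a q : ℝ)

/-- A rank function: `o n` counts the indices of smaller rank. -/
def IsRank {d : ℕ} (o : Fin d → ℕ) : Prop :=
  ∀ n, o n = (Finset.univ.filter fun m => o m < o n).card

/-- The indices of rank at least that of `n`. -/
def rankUpper {d : ℕ} (o : Fin d → ℕ) (n : Fin d) : NES d :=
  ⟨Finset.univ.filter fun m => o n ≤ o m, n, by simp⟩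

/-- The supports of the `w S` are the sets of elements of minimal rank. -/
def SuppRank {d : ℕ} (w : Ew d) (o : Fin d → ℕ) : Prop :=
  ∀ S n, w S n ≠ 0 ↔ n ∈ S.1 ∧ ∀ m ∈ S.1, o n ≤ o m

lemma Cc_pos {d : ℕ} {lam : Fin d → ℝ} (hlam : Function.Injective lam) {i : Fin d}
    {T : Finset (Fin d)} (h : i ∉ T) : 0 < Cc lam i T := by
  refine Finset.prod_pos fun t ht => ?_
  have : lam t - lam i ≠ 0 := sub_ne_zero.2 fun e => h (hlam e ▸ ht)
  positivity

lemma Bset.transfer {d : ℕ} {lam : Fin d → ℝ} (hlam : Function.Injective lam) {w : Ew d}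
    (hw : w ∈ Bset lam) {R S : NES d} (hRS : R.1 ⊆ S.1) {n m : Fin d} (hn : n ∈ R.1)
    (hm : m ∈ R.1) (h1 : w R n ≠ 0) (h2 : w S m ≠ 0) : w S n ≠ 0 ∧ w R m ≠ 0 := by
  have h := hw.2.2.2 R S hRS n hn m hm
  have hc : Cc lam m (S.1 \ R.1) ≠ 0 := (Cc_pos hlam (by simp [hm])).ne'
  have h3 : Cc lam m (S.1 \ R.1) * w R n * w S m ≠ 0 := by positivity
  rw [← h] at h3
  constructor <;> intro h4 <;> simp [h4] at h3

lemma Bset.exists_ne {d : ℕ} {lam : Fin d → ℝ} {w : Ew d} (hw : w ∈ Bset lam) (S : NES d) :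
    ∃ n ∈ S.1, w S n ≠ 0 := by
  by_contra! h
  have := hw.2.2.1 S
  rw [Finset.sum_eq_zero h] at this
  norm_num at this

lemma Bset.exists_rank {d : ℕ} {lam : Fin d → ℝ} (hlam : Function.Injective lam) {w : Ew d}
    (hw : w ∈ Bset lam) : ∃ o : Fin d → ℕ, IsRank o ∧ SuppRank w o := by
  classical
  let pr : Fin d → Fin d → NES d := fun n m => ⟨{n, m}, n, by simp⟩
  have pr_comm : ∀ n m, pr n m = pr m n := fun n m => Subtype.ext (Finset.pair_comm n m)
  let le : Fin d → Fin d → Prop := fun n m => w (pr n m) n ≠ 0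
  have supp : ∀ S n, w S n ≠ 0 ↔ n ∈ S.1 ∧ ∀ m ∈ S.1, le n m := by
    intro S n
    constructor
    · intro h
      have hn : n ∈ S.1 := by
        by_contra hn
        exact h (hw.1 S n hn)
      refine ⟨hn, fun m hm => ?_⟩
      have hsub : (pr n m).1 ⊆ S.1 := by
        intro x hx
        rcases (by simpa [pr] using hx : x = n ∨ x = m) with rfl | rfl <;> assumption
      obtain ⟨x, hx, hx0⟩ := Bset.exists_ne hw (pr n m)
      rcases (by simpa [pr] using hx : x = n ∨ x = m) with rfl | rfl
      · exact hx0
      · exact (Bset.transfer hlam hw hsub (n := x) (m := n) (by simp [pr]) (by simp [pr]) hx0 h).2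
    · rintro ⟨hn, h⟩
      obtain ⟨m, hm, hm0⟩ := Bset.exists_ne hw S
      have hsub : (pr n m).1 ⊆ S.1 := by
        intro x hx
        rcases (by simpa [pr] using hx : x = n ∨ x = m) with rfl | rfl <;> assumption
      exact (Bset.transfer hlam hw hsub (n := n) (m := m) (by simp [pr]) (by simp [pr])
        (h m hm) hm0).1
  have total : ∀ n m, le n m ∨ le m n := by
    intro n m
    obtain ⟨x, hx, hx0⟩ := Bset.exists_ne hw (pr n m)
    rcases (by simpa [pr] using hx : x = n ∨ x = m) with rfl | rfl
    · exact Or.inl hx0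
    · exact Or.inr (by simpa only [le, pr_comm] using hx0)
  have refl : ∀ n, le n n := fun n => (total n n).elim id id
  have trans : ∀ n m l, le n m → le m l → le n l := by
    intro n m l h1 h2
    let S : NES d := ⟨{n, m, l}, n, by simp⟩
    have s1 : (pr n m).1 ⊆ S.1 := by intro x; simp [pr, S]; tauto
    have s2 : (pr m l).1 ⊆ S.1 := by intro x; simp [pr, S]; tauto
    have a1 : w S m ≠ 0 → w S n ≠ 0 := fun h =>
      (Bset.transfer hlam hw s1 (by simp [pr]) (by simp [pr]) h1 h).1
    have a2 : w S l ≠ 0 → w S m ≠ 0 := fun h =>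
      (Bset.transfer hlam hw s2 (by simp [pr]) (by simp [pr]) h2 h).1
    have a3 : w S n ≠ 0 := by
      obtain ⟨x, hx, hx0⟩ := Bset.exists_ne hw S
      rcases (by simpa [S] using hx : x = n ∨ x = m ∨ x = l) with rfl | rfl | rfl
      · exact hx0
      · exact a1 hx0
      · exact a1 (a2 hx0)
    exact ((supp S n).1 a3).2 l (by simp [S])
  let o : Fin d → ℕ := fun n => (Finset.univ.filter fun m => ¬ le n m).card
  have ho : ∀ n m, le n m ↔ o n ≤ o m := by
    intro n m
    constructor
    · intro h
      refine Finset.card_le_card fun x hx => ?_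
      simp only [Finset.mem_filter, Finset.mem_univ, true_and] at hx ⊢
      exact fun h' => hx (trans _ _ _ h h')
    · intro h
      by_contra hn
      refine absurd h (not_le.2 (Finset.card_lt_card ?_))
      have hn : ¬ le n m := fun h => h hn
      have hmn := (total n m).resolve_left hn
      refine (Finset.ssubset_iff_of_subset fun x hx => ?_).2 ⟨m,
        Finset.mem_filter.2 ⟨Finset.mem_univ _, hn⟩,
        fun h' => (Finset.mem_filter.1 h').2 (refl m)⟩
      simp only [Finset.mem_filter, Finset.mem_univ, true_and] at hx ⊢
      exact fun h' => hx (trans _ _ _ hmn h')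
  refine ⟨o, fun n => ?_, fun S n => ?_⟩
  · change (Finset.univ.filter fun m => ¬ le n m).card = _
    congr 1
    ext m
    simp [ho]
  · rw [supp]
    simp only [ho]

lemma Bset.mul_sum_eq {d : ℕ} {lam : Fin d → ℝ} {w : Ew d} (hw : w ∈ Bset lam)
    {S K : NES d} (h : S.1 ⊆ K.1) {i : Fin d} (hi : i ∈ S.1) :
    w S i * ∑ j ∈ S.1, Cc lam j (K.1 \ S.1) * w K j = Cc lam i (K.1 \ S.1) * w K i := by
  have h1 : ∀ j ∈ S.1, w S i * (Cc lam j (K.1 \ S.1) * w K j)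
      = Cc lam i (K.1 \ S.1) * w K i * w S j := by
    intro j hj
    have := hw.2.2.2 S K h i hi j hj
    linarith
  rw [Finset.mul_sum, Finset.sum_congr rfl h1, ← Finset.mul_sum, hw.2.2.1 S, mul_one]

lemma Bset.sum_pos {d : ℕ} {lam : Fin d → ℝ} (hlam : Function.Injective lam) {w : Ew d}
    (hw : w ∈ Bset lam) {S K : NES d} {n : Fin d} (hn : n ∈ S.1) (hK : w K n ≠ 0) :
    0 < ∑ j ∈ S.1, Cc lam j (K.1 \ S.1) * w K j := by
  have hc : ∀ j ∈ S.1, 0 < Cc lam j (K.1 \ S.1) := fun j hj => Cc_pos hlam (by simp [hj])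
  refine Finset.sum_pos' (fun j hj => mul_nonneg (hc j hj).le (hw.2.1 K j)) ⟨n, hn, ?_⟩
  exact mul_pos (hc n hn) ((hw.2.1 K n).lt_of_ne' hK)

lemma SuppRank.exists_rankUpper {d : ℕ} {lam : Fin d → ℝ} {w : Ew d}
    (hw : w ∈ Bset lam) {o : Fin d → ℕ} (ho : SuppRank w o) (S : NES d) :
    ∃ n ∈ S.1, (∀ m ∈ S.1, o n ≤ o m) ∧ S.1 ⊆ (rankUpper o n).1 ∧ w (rankUpper o n) n ≠ 0 := by
  obtain ⟨n, hn, h0⟩ := Bset.exists_ne hw S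
  have h1 := ((ho S n).1 h0).2
  refine ⟨n, hn, h1, fun m hm => by simpa [rankUpper] using h1 m hm, (ho _ _).2 ?_⟩
  simp [rankUpper]

/-- An element of `B` is determined by its ranks and its weights on the rankUpper sets. -/
lemma Bset.ext_of_rank {d : ℕ} {lam : Fin d → ℝ} (hlam : Function.Injective lam) {w w' : Ew d}
    (hw : w ∈ Bset lam) (hw' : w' ∈ Bset lam) {o : Fin d → ℕ} (ho : SuppRank w o)
    (h : ∀ n, w (rankUpper o n) = w' (rankUpper o n)) : w = w' := by
  funext S
  obtain ⟨n, hn, -, hsub, h0⟩ := ho.exists_rankUpper hw S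
  funext i
  by_cases hi : i ∈ S.1
  · have e1 := Bset.mul_sum_eq hw hsub hi
    have e2 := Bset.mul_sum_eq hw' hsub hi
    rw [← h n] at e2
    exact mul_right_cancel₀ (Bset.sum_pos hlam hw hn h0).ne' (e1.trans e2.symm)
  · rw [hw.1 S i hi, hw'.1 S i hi]

/-- Every rank function and positive weights give an element of `B`. -/
lemma Bset.exists_of_rank {d : ℕ} {lam : Fin d → ℝ} (hlam : Function.Injective lam)
    (o : Fin d → ℕ) (v : Fin d → ℝ) (hv : ∀ i, 0 < v i)
    (hsum : ∀ n, ∑ i, (if o i = o n then v i else 0) = 1) :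
    ∃ w ∈ Bset lam, SuppRank w o ∧
      ∀ n i, w (rankUpper o n) i = if o i = o n then v i else 0 := by
  classical
  let A : NES d → Fin d → ℝ := fun S i =>
    if i ∈ S.1 ∧ ∀ m ∈ S.1, o i ≤ o m then Cc lam i ((rankUpper o i).1 \ S.1) * v i else 0
  have Apos : ∀ S i, (i ∈ S.1 ∧ ∀ m ∈ S.1, o i ≤ o m) → 0 < A S i := by
    intro S i h
    simp only [A, if_pos h]
    exact mul_pos (Cc_pos hlam (by simp [h.1])) (hv i)
  have Anon : ∀ S i, 0 ≤ A S i := by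
    intro S i
    by_cases h : i ∈ S.1 ∧ ∀ m ∈ S.1, o i ≤ o m
    · exact (Apos S i h).le
    · simp only [A, if_neg h, le_refl]
  have Dpos : ∀ S : NES d, 0 < ∑ i ∈ S.1, A S i := by
    intro S
    obtain ⟨n, hn, h⟩ := S.1.exists_min_image o S.2
    exact Finset.sum_pos' (fun i _ => Anon S i) ⟨n, hn, Apos S n ⟨hn, h⟩⟩
  have supp : ∀ S n, A S n / (∑ j ∈ S.1, A S j) ≠ 0 ↔ n ∈ S.1 ∧ ∀ m ∈ S.1, o n ≤ o m := by
    intro S n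
    constructor
    · intro h
      by_contra h'
      simp only [A, if_neg h', zero_div, ne_eq, not_true_eq_false] at h
    · intro h
      exact (div_pos (Apos S n h) (Dpos S)).ne'
  refine ⟨fun S i => A S i / ∑ j ∈ S.1, A S j, ⟨?_, ?_, ?_, ?_⟩, supp, ?_⟩
  · intro S n hn
    by_contra h
    exact hn ((supp S n).1 h).1
  · intro S n
    exact div_nonneg (Anon S n) (Dpos S).le
  · intro S
    rw [← Finset.sum_div, div_self (Dpos S).ne']
  · intro R S hRS i hi j hj
    have key : Cc lam i (S.1 \ R.1) * A R j * A S i = Cc lam j (S.1 \ R.1) * A R i * A S j := by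
      have z1 : ∀ x ∈ R.1, A R x = 0 → A S x = 0 := by
        intro x hx h
        by_contra h'
        have h2 : x ∈ S.1 ∧ ∀ m ∈ S.1, o x ≤ o m := by
          by_contra h3
          exact h' (if_neg h3)
        exact (Apos R x ⟨hx, fun m hm => h2.2 m (hRS hm)⟩).ne' h
      by_cases c1 : A R i = 0
      · simp [c1, z1 i hi c1]
      by_cases c2 : A R j = 0
      · simp [c2, z1 j hj c2]
      have r1 : i ∈ R.1 ∧ ∀ m ∈ R.1, o i ≤ o m := by
        by_contra h3
        exact c1 (if_neg h3)
      have r2 : j ∈ R.1 ∧ ∀ m ∈ R.1, o j ≤ o m := by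
        by_contra h3
        exact c2 (if_neg h3)
      have hij : o i = o j := le_antisymm (r1.2 j hj) (r2.2 i hi)
      have hup : rankUpper o j = rankUpper o i := by
        apply Subtype.ext
        simp [rankUpper, hij]
      by_cases c3 : ∀ m ∈ S.1, o i ≤ o m
      · have split : ∀ x, Cc lam x ((rankUpper o i).1 \ R.1)
            = Cc lam x (S.1 \ R.1) * Cc lam x ((rankUpper o i).1 \ S.1) := by
          intro x
          unfold Cc
          rw [← Finset.prod_union]
          · congr 1
            ext y
            simp only [Finset.mem_sdiff, Finset.mem_union, rankUpper, Finset.mem_filter,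
              Finset.mem_univ, true_and]
            constructor
            · tauto
            · rintro (⟨h1, h2⟩ | ⟨h1, h2⟩)
              · exact ⟨c3 y h1, h2⟩
              · exact ⟨h1, fun h => h2 (hRS h)⟩
          · rw [Finset.disjoint_left]
            intro y hy
            simp only [Finset.mem_sdiff] at hy ⊢
            tauto
        have s1 : i ∈ S.1 ∧ ∀ m ∈ S.1, o i ≤ o m := ⟨hRS hi, c3⟩
        have s2 : j ∈ S.1 ∧ ∀ m ∈ S.1, o j ≤ o m := ⟨hRS hj, hij ▸ c3⟩
        simp only [A, if_pos r1, if_pos r2, if_pos s1, if_pos s2, hup, split]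
        ring
      · have s1 : A S i = 0 := if_neg fun h => c3 h.2
        have s2 : A S j = 0 := if_neg fun h => c3 (hij ▸ h.2)
        simp [s1, s2]
    have h1 := (Dpos R).ne'
    have h2 := (Dpos S).ne'
    dsimp only
    field_simp
    linarith
  · intro n i
    have hA : ∀ i, A (rankUpper o n) i = if o i = o n then v i else 0 := by
      intro i
      by_cases h : o i = o n
      · have h1 : i ∈ (rankUpper o n).1 ∧ ∀ m ∈ (rankUpper o n).1, o i ≤ o m := by simp [rankUpper, h]
        have h2 : rankUpper o i = rankUpper o n := by
          apply Subtype.ext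
          simp [rankUpper, h]
        simp only [A, if_pos h1, if_pos h, h2, sdiff_self]
        simp [Cc]
      · have h1 : ¬ (i ∈ (rankUpper o n).1 ∧ ∀ m ∈ (rankUpper o n).1, o i ≤ o m) := by
          rintro ⟨h2, h3⟩
          exact h (le_antisymm (h3 n (by simp [rankUpper])) (by simpa [rankUpper] using h2))
        simp only [A, if_neg h1, if_neg h]
    have hs : ∑ j ∈ (rankUpper o n).1, A (rankUpper o n) j = 1 := by
      rw [← hsum n, Finset.sum_congr rfl fun j _ => hA j]
      refine Finset.sum_subset (Finset.subset_univ _) fun x _ hx => if_neg fun h => hx ?_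
      simp [rankUpper, h]
    dsimp only
    rw [hs, div_one, hA]

/-- The eigenvector rows `u k` of a tridiagonal symmetric matrix with diagonal `a`, off-diagonal
`β` (`β k` linking rows `k - 1` and `k`) and eigenvalues `lam`, with nonnegative off-diagonal. -/
structure EigenRows (d : ℕ) (lam : Fin d → ℝ) (a β : ℕ → ℝ) (u : ℕ → Fin d → ℝ) : Prop where
  rec_eq : ∀ k < d, ∀ i, lam i * u k i = β k * u (k - 1) i + a k * u k i + β (k + 1) * u (k + 1) i
  zero : β 0 = 0
  last : β d = 0
  nonneg : ∀ k, 0 ≤ β k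
  row : ∀ k < d, ∀ l < d, ∑ i, u k i * u l i = if k = l then 1 else 0
  col : ∀ i j, ∑ k ∈ Finset.range d, u k i * u k j = if i = j then 1 else 0

/-- `c i` is the first row in which the `i`-th column is nonzero. -/
def FirstRow {d : ℕ} (u : ℕ → Fin d → ℝ) (c : Fin d → ℕ) : Prop :=
  ∀ i, c i < d ∧ u (c i) i ≠ 0 ∧ ∀ l < c i, u l i = 0

namespace EigenRows

variable {d : ℕ} {lam : Fin d → ℝ} {a β : ℕ → ℝ} {u : ℕ → Fin d → ℝ} {c : Fin d → ℕ}

lemma exists_firstRow (h : EigenRows d lam a β u) : ∃ c, FirstRow u c := by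
  classical
  have h1 : ∀ i, ∃ k, k < d ∧ u k i ≠ 0 := by
    intro i
    by_contra! h0
    have h2 := h.col i i
    rw [Finset.sum_eq_zero fun k hk => by rw [h0 k (Finset.mem_range.1 hk), zero_mul]] at h2
    simp at h2
  refine ⟨fun i => Nat.find (h1 i), fun i => ⟨(Nat.find_spec (h1 i)).1, (Nat.find_spec (h1 i)).2, ?_⟩⟩
  intro l hl
  by_contra hne
  exact Nat.find_min (h1 i) hl ⟨hl.trans (Nat.find_spec (h1 i)).1, hne⟩

lemma christoffel_darboux (h : EigenRows d lam a β u) (i j : Fin d) {k : ℕ} (hk : k ≤ d) :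
    (lam i - lam j) * ∑ l ∈ Finset.range k, u l i * u l j
      = β k * (u k i * u (k - 1) j - u (k - 1) i * u k j) := by
  induction k with
  | zero => simp [h.zero]
  | succ k ih =>
    rw [Finset.sum_range_succ, mul_add, ih (by omega), Nat.add_sub_cancel]
    have h1 := h.rec_eq k hk i
    have h2 := h.rec_eq k hk j
    linear_combination u k j * h1 - u k i * h2

lemma trunc_orthogonal (hlam : Function.Injective lam) (h : EigenRows d lam a β u) {k : ℕ} (hk : k ≤ d) (hβ : β k = 0)
    {i j : Fin d} (hij : i ≠ j) : ∑ l ∈ Finset.range k, u l i * u l j = 0 := by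
  have h1 := h.christoffel_darboux i j hk
  rw [hβ, zero_mul] at h1
  exact (mul_eq_zero.1 h1).resolve_left (sub_ne_zero.2 fun e => hij (hlam e))

lemma eq_zero_of_break (hlam : Function.Injective lam) (h : EigenRows d lam a β u) (hc : FirstRow u c) {k : ℕ} (hk : k ≤ d)
    (hβ : β k = 0) {i : Fin d} (hi : c i < k) {m : ℕ} (hm : k ≤ m) (hmd : m < d) : u m i = 0 := by
  have h1 : ∑ j, (∑ l ∈ Finset.range k, u l i * u l j) * u m j = 0 := by
    simp_rw [Finset.sum_mul]
    rw [Finset.sum_comm]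
    refine Finset.sum_eq_zero fun l hl => ?_
    have hl := Finset.mem_range.1 hl
    simp_rw [mul_assoc]
    rw [← Finset.mul_sum, h.row l (by omega) m hmd, if_neg (by omega), mul_zero]
  rw [Finset.sum_eq_single i (fun j _ hj => by
    rw [h.trunc_orthogonal hlam hk hβ hj.symm, zero_mul]) (by simp)] at h1
  refine (mul_eq_zero.1 h1).resolve_left (ne_of_gt ?_)
  refine Finset.sum_pos' (fun l _ => mul_self_nonneg _) ⟨c i, Finset.mem_range.2 hi, ?_⟩
  exact mul_self_pos.2 (hc i).2.1

lemma card_of_break (hlam : Function.Injective lam) (h : EigenRows d lam a β u) (hc : FirstRow u c) {k : ℕ} (hk : k ≤ d)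
    (hβ : β k = 0) : (Finset.univ.filter fun i => c i < k).card = k := by
  have h1 : ∀ i, ∑ l ∈ Finset.range k, u l i * u l i = if c i < k then 1 else 0 := by
    intro i
    split_ifs with hi
    · have h2 := h.col i i
      rw [if_pos rfl] at h2
      rw [← h2]
      refine Finset.sum_subset (Finset.range_subset_range.2 hk) fun l hl hl' => ?_
      rw [h.eq_zero_of_break hlam hc hk hβ hi (by simpa using hl') (by simpa using hl), zero_mul]
    · refine Finset.sum_eq_zero fun l hl => ?_
      rw [(hc i).2.2 l (by have := Finset.mem_range.1 hl; omega), zero_mul]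
  have h2 : ∑ i, ∑ l ∈ Finset.range k, u l i * u l i = k := by
    rw [Finset.sum_comm]
    rw [Finset.sum_congr rfl fun l hl => by
      have := Finset.mem_range.1 hl
      rw [h.row l (by omega) l (by omega), if_pos rfl]]
    simp
  simp_rw [h1] at h2
  rw [Finset.sum_ite] at h2
  simp only [Finset.sum_const, nsmul_eq_mul, mul_one, mul_zero, add_zero] at h2
  exact_mod_cast h2

lemma beta_firstRow (h : EigenRows d lam a β u) (hc : FirstRow u c) (i : Fin d) :
    β (c i) = 0 := by
  obtain ⟨h1, h2, h3⟩ := hc i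
  rcases Nat.eq_zero_or_pos (c i) with h0 | h0
  · rw [h0, h.zero]
  · have h4 := h.rec_eq (c i - 1) (by omega) i
    rw [h3 _ (by omega), h3 (c i - 1 - 1) (by omega), Nat.sub_add_cancel h0] at h4
    simpa [h2] using h4

lemma isRank (hlam : Function.Injective lam) (h : EigenRows d lam a β u) (hc : FirstRow u c) : IsRank c := fun n =>
  (h.card_of_break hlam hc (hc n).1.le (h.beta_firstRow hc n)).symm

lemma firstRow_eq (hlam : Function.Injective lam) (h : EigenRows d lam a β u) (hc : FirstRow u c) {n i : Fin d}
    (hne : u (c n) i ≠ 0) : c i = c n := by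
  rcases lt_trichotomy (c i) (c n) with h1 | h1 | h1
  · exact absurd (h.eq_zero_of_break hlam hc (hc n).1.le (h.beta_firstRow hc n) h1 le_rfl
      (hc n).1) hne
  · exact h1
  · exact absurd ((hc i).2.2 _ h1) hne

end EigenRows

lemma IsRank.card_le_eq {d : ℕ} {c : Fin d → ℕ} (hc : IsRank c) (n : Fin d) :
    (Finset.univ.filter fun i => c i ≤ c n).card
      = c n + (Finset.univ.filter fun i => c i = c n).card := by
  have h : (Finset.univ.filter fun i => c i ≤ c n) = (Finset.univ.filter fun i => c i < c n)
      ∪ Finset.univ.filter fun i => c i = c n := by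
    ext i
    simp [le_iff_lt_or_eq]
  rw [h, Finset.card_union_of_disjoint, ← hc n]
  rw [Finset.disjoint_filter]
  intro i _ h1 h2
  omega

lemma IsRank.card_le_le {d : ℕ} {c : Fin d → ℕ} (hc : IsRank c) {n i : Fin d} (h : c n < c i) :
    c n + (Finset.univ.filter fun i => c i = c n).card ≤ c i := by
  rw [← hc.card_le_eq, hc i]
  refine Finset.card_le_card fun m => ?_
  simp only [Finset.mem_filter, Finset.mem_univ, true_and]
  omega

lemma IsRank.card_rankUpper {d : ℕ} {c : Fin d → ℕ} (hc : IsRank c) (n : Fin d) :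
    (rankUpper c n).1.card + c n = d := by
  have h := Finset.card_filter_add_card_filter_not (s := (Finset.univ : Finset (Fin d)))
    (fun m => c m < c n)
  rw [← hc n, Finset.card_univ, Fintype.card_fin] at h
  rw [add_comm]
  convert h using 3
  ext m
  simp [rankUpper]

lemma IsRank.sort_le {d : ℕ} {c : Fin d → ℕ} (hc : IsRank c) (k : Fin d) :
    c (Tuple.sort c k) ≤ k := by
  have hmono := Tuple.monotone_sort c
  set σ := Tuple.sort c
  conv_lhs => rw [hc (σ k)]
  calc _ ≤ ((Finset.Iio k).map σ.toEmbedding).card := by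
        refine Finset.card_le_card fun m hm => ?_
        simp only [Finset.mem_filter, Finset.mem_univ, true_and] at hm
        refine Finset.mem_map.2 ⟨σ.symm m, ?_, by simp⟩
        rw [Finset.mem_Iio]
        by_contra hk
        have := hmono (not_lt.1 hk)
        simp only [Function.comp, Equiv.apply_symm_apply] at this
        omega
    _ = k := by simp

lemma IsRank.lt_sort {d : ℕ} {c : Fin d → ℕ} (hc : IsRank c) (k : Fin d) :
    (k : ℕ) < c (Tuple.sort c k)
      + (Finset.univ.filter fun i => c i = c (Tuple.sort c k)).card := by
  have hmono := Tuple.monotone_sort c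
  rw [← hc.card_le_eq]
  set σ := Tuple.sort c
  calc (k : ℕ) < ((Finset.Iic k).map σ.toEmbedding).card := by simp
    _ ≤ _ := by
        refine Finset.card_le_card fun m hm => ?_
        obtain ⟨l, hl, rfl⟩ := Finset.mem_map.1 hm
        simpa using hmono (Finset.mem_Iic.1 hl)

namespace EigenRows

variable {d : ℕ} {lam : Fin d → ℝ} {a β : ℕ → ℝ} {u : ℕ → Fin d → ℝ} {c : Fin d → ℕ}

lemma firstRow_eq_of_block (hlam : Function.Injective lam) (h : EigenRows d lam a β u)
    (hc : FirstRow u c) {n i : Fin d} {p : ℕ} (hpd : p < d) (h1 : c n ≤ p)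
    (h2 : p < c n + (Finset.univ.filter fun i => c i = c n).card) (hne : u p i ≠ 0) :
    c i = c n := by
  rcases lt_trichotomy (c i) (c n) with h3 | h3 | h3
  · exact absurd (h.eq_zero_of_break hlam hc (hc n).1.le (h.beta_firstRow hc n) h3 h1 hpd) hne
  · exact h3
  · have := (h.isRank hlam hc).card_le_le h3
    exact absurd ((hc i).2.2 p (by omega)) hne

lemma beta_pos_of_block (hlam : Function.Injective lam) (h : EigenRows d lam a β u)
    (hc : FirstRow u c) {n : Fin d} {p : ℕ} (hpd : p < d) (h1 : c n ≤ p)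
    (h2 : p + 1 < c n + (Finset.univ.filter fun i => c i = c n).card) : 0 < β (p + 1) := by
  refine (h.nonneg _).lt_of_ne' fun h0 => ?_
  have hr := h.isRank hlam hc
  have h3 := h.card_of_break hlam hc hpd h0
  have h4 : (Finset.univ.filter fun i => c i < p + 1)
      = Finset.univ.filter fun i => c i ≤ c n := by
    ext i
    simp only [Finset.mem_filter, Finset.mem_univ, true_and]
    constructor
    · intro h5
      by_contra h6
      have := hr.card_le_le (not_le.1 h6)
      omega
    · omega
  rw [h4, hr.card_le_eq] at h3
  omega

lemma diag_eq (h : EigenRows d lam a β u) {k : ℕ} (hk : k < d) :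
    a k = ∑ i, lam i * u k i * u k i := by
  have h1 : ∀ i, lam i * u k i * u k i
      = β k * (u (k - 1) i * u k i) + a k * (u k i * u k i) + β (k + 1) * (u (k + 1) i * u k i) := by
    intro i
    rw [h.rec_eq k hk i]
    ring
  simp_rw [h1, Finset.sum_add_distrib, ← Finset.mul_sum]
  rw [h.row k hk k hk, if_pos rfl]
  have e1 : β k * ∑ i, u (k - 1) i * u k i = 0 := by
    rcases Nat.eq_zero_or_pos k with h0 | h0
    · rw [h0, h.zero, zero_mul]
    · rw [h.row _ (by omega) _ hk, if_neg (by omega), mul_zero]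
  have e2 : β (k + 1) * ∑ i, u (k + 1) i * u k i = 0 := by
    rcases eq_or_lt_of_le (Nat.succ_le_of_lt hk) with h0 | h0
    · rw [show k + 1 = d from h0, h.last, zero_mul]
    · rw [h.row _ h0 _ hk, if_neg (by omega), mul_zero]
  rw [e1, e2]
  ring

end EigenRows

lemma ip_restr {d : ℕ} (Q : Finset (Fin d)) (lam v : Fin d → ℝ) (p q : ℝ[X]) :
    ip (restr Q lam) (restr Q v) p q = ∑ i ∈ Q, p.eval (lam i) * q.eval (lam i) * v i := by
  unfold ip restr
  rw [← Finset.sum_coe_sort Q]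
  exact Equiv.sum_comp (Q.orderIsoOfFin rfl).toEquiv
    fun i : Q => p.eval (lam i) * q.eval (lam i) * v i

namespace EigenRows

variable {d : ℕ} {lam : Fin d → ℝ} {a β : ℕ → ℝ} {u : ℕ → Fin d → ℝ} {c : Fin d → ℕ}

/-- The rows of a block are obtained from its first row by the orthogonal polynomials. -/
lemma lanczos (hlam : Function.Injective lam) (h : EigenRows d lam a β u) (hc : FirstRow u c)
    (n : Fin d) {Q : Finset (Fin d)} (hQ : Q = Finset.univ.filter fun i => c i = c n)
    {v : Fin d → ℝ} (hv : ∀ i ∈ Q, v i = u (c n) i ^ 2) :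
    (∀ t < Q.card, fEnt (restr Q lam) (restr Q v) (2 * t + 1) = a (c n + t)) ∧
      ∀ t, t + 1 < Q.card → fEnt (restr Q lam) (restr Q v) (2 * (t + 1)) = β (c n + t + 1) := by
  set L := restr Q lam
  set V := restr Q v
  have hcard : c n + Q.card ≤ d := by
    rw [hQ, ← (h.isRank hlam hc).card_le_eq]
    exact (Finset.card_le_univ _).trans (by simp)
  have hout : ∀ i, i ∉ Q → u (c n) i = 0 := by
    intro i hi
    by_contra hne
    exact hi (by rw [hQ]; simpa using h.firstRow_eq hlam hc hne)
  have hip : ∀ p q : ℝ[X], ip L V p q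
      = ∑ i, (p.eval (lam i) * u (c n) i) * (q.eval (lam i) * u (c n) i) := by
    intro p q
    rw [ip_restr, ← Finset.sum_subset (Finset.subset_univ Q)]
    · refine Finset.sum_congr rfl fun i hi => ?_
      rw [hv i hi]
      ring
    · intro i _ hi
      rw [hout i hi]
      ring
  have hnorm : ∀ t, t < Q.card → ∀ γ : ℝ,
      (∀ i, (opAux L V t).1.eval (lam i) * u (c n) i = γ * u (c n + t) i) →
      ip L V (opAux L V t).1 (opAux L V t).1 = γ ^ 2 ∧
      ip L V (opAux L V t).1 (X * (opAux L V t).1) = a (c n + t) * γ ^ 2 := by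
    intro t ht γ hγ
    constructor
    · have hrow := h.row (c n + t) (by omega) (c n + t) (by omega)
      rw [if_pos rfl] at hrow
      rw [hip, ← mul_one (γ ^ 2), ← hrow, Finset.mul_sum]
      refine Finset.sum_congr rfl fun i _ => ?_
      rw [hγ i]
      ring
    · rw [hip, h.diag_eq (k := c n + t) (by omega), Finset.sum_mul]
      refine Finset.sum_congr rfl fun i _ => ?_
      rw [eval_mul, eval_X]
      linear_combination lam i * ((opAux L V t).1.eval (lam i) * u (c n) i
        + γ * u (c n + t) i) * hγ i
  have inv : ∀ t, t < Q.card → ∃ γ : ℝ, 0 < γ ∧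
      (∀ i, (opAux L V t).1.eval (lam i) * u (c n) i = γ * u (c n + t) i) ∧
      (∀ i, ip L V (opAux L V t).1 (opAux L V t).1 / ip L V (opAux L V t).2 (opAux L V t).2 *
        ((opAux L V t).2.eval (lam i) * u (c n) i) = γ * β (c n + t) * u (c n + t - 1) i) ∧
      (t + 1 < Q.card → ∀ i, (opAux L V (t + 1)).1.eval (lam i) * u (c n) i
        = γ * β (c n + t + 1) * u (c n + (t + 1)) i) := by
    have step : ∀ t, t < Q.card → ∀ γ : ℝ, 0 < γ →
      (∀ i, (opAux L V t).1.eval (lam i) * u (c n) i = γ * u (c n + t) i) →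
      (∀ i, ip L V (opAux L V t).1 (opAux L V t).1 / ip L V (opAux L V t).2 (opAux L V t).2 *
        ((opAux L V t).2.eval (lam i) * u (c n) i) = γ * β (c n + t) * u (c n + t - 1) i) →
      ∀ i, (opAux L V (t + 1)).1.eval (lam i) * u (c n) i
        = γ * β (c n + t + 1) * u (c n + (t + 1)) i := by
      intro t ht γ hγ0 hγ hβ i
      obtain ⟨e1, e2⟩ := hnorm t ht γ hγ
      have e6 : ip L V (opAux L V t).1 (X * (opAux L V t).1) /
          ip L V (opAux L V t).1 (opAux L V t).1 = a (c n + t) := by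
        rw [e2, e1, mul_div_assoc, div_self (by positivity), mul_one]
      have e3 := hβ i
      have e4 := hγ i
      have e5 := h.rec_eq (c n + t) (by omega) i
      simp only [opAux, eval_sub, eval_mul, eval_X, eval_C]
      rw [e6, ← add_assoc]
      linear_combination (lam i - a (c n + t)) * e4 - e3 + γ * e5
    intro t
    induction t with
    | zero =>
      intro ht
      have h1 : ∀ i, (opAux L V 0).1.eval (lam i) * u (c n) i = 1 * u (c n + 0) i := by
        simp [opAux]
      have h2 : ∀ i, ip L V (opAux L V 0).1 (opAux L V 0).1 /
          ip L V (opAux L V 0).2 (opAux L V 0).2 *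
          ((opAux L V 0).2.eval (lam i) * u (c n) i) = 1 * β (c n + 0) * u (c n + 0 - 1) i := by
        simp [opAux, h.beta_firstRow hc n]
      exact ⟨1, one_pos, h1, h2, fun _ => step 0 ht 1 one_pos h1 h2⟩
    | succ t ih =>
      intro ht
      obtain ⟨γ, hγ0, hγ, -, hs⟩ := ih (by omega)
      have hb := h.beta_pos_of_block hlam hc (n := n) (p := c n + t) (by omega) (by omega)
        (by rw [← hQ]; omega)
      have h1 := hs ht
      have h2 : ∀ i, ip L V (opAux L V (t + 1)).1 (opAux L V (t + 1)).1 /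
          ip L V (opAux L V (t + 1)).2 (opAux L V (t + 1)).2 *
          ((opAux L V (t + 1)).2.eval (lam i) * u (c n) i)
          = γ * β (c n + t + 1) * β (c n + (t + 1)) * u (c n + (t + 1) - 1) i := by
        intro i
        rw [(hnorm (t + 1) ht _ h1).1]
        change _ / ip L V (opAux L V t).1 (opAux L V t).1 *
          ((opAux L V t).1.eval (lam i) * u (c n) i) = _
        rw [(hnorm t (by omega) _ hγ).1, hγ i, ← add_assoc, Nat.add_sub_cancel]
        field_simp
      exact ⟨γ * β (c n + t + 1), by positivity, h1, h2,
        fun _ => step (t + 1) ht _ (by positivity) h1 h2⟩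
  constructor
  · intro t ht
    obtain ⟨γ, hγ0, hγ, -, -⟩ := inv t ht
    obtain ⟨e1, e2⟩ := hnorm t ht γ hγ
    have : (2 * t + 1) / 2 = t := by omega
    simp only [fEnt, op, show (2 * t + 1) % 2 = 1 by omega, if_true, this]
    rw [e1, e2, mul_div_assoc, div_self (by positivity), mul_one]
  · intro t ht
    obtain ⟨γ, hγ0, hγ, -, hs⟩ := inv t (by omega)
    have e1 := (hnorm t (by omega) γ hγ).1
    have e2 := (hnorm (t + 1) ht _ (hs ht)).1
    have h1 : 2 * (t + 1) / 2 = t + 1 := by omega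
    simp only [fEnt, op, show ¬ 2 * (t + 1) % 2 = 1 by omega, if_false, h1, Nat.add_sub_cancel]
    rw [e1, e2, mul_pow, mul_div_assoc, mul_comm, div_mul_cancel₀ _ (by positivity),
      Real.sqrt_sq (h.nonneg _)]

end EigenRows
/-- The vectors `y S`, with squares `w S`, lie in the span of the first `d - |S| + 1` rows. -/
def Linked {d : ℕ} (u : ℕ → Fin d → ℝ) (y w : Ew d) : Prop :=
  ∀ S : NES d, (∀ k < d, d < k + S.1.card → ∑ i, u k i * y S i = 0) ∧ ∀ i, w S i = y S i ^ 2

namespace EigenRows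

variable {d : ℕ} {lam : Fin d → ℝ} {a β : ℕ → ℝ} {u : ℕ → Fin d → ℝ} {c : Fin d → ℕ}

lemma linked_eq (h : EigenRows d lam a β u) (hc : FirstRow u c) {y w : Ew d} (hw : w ∈ Bset lam)
    (hy : Linked u y w) {k : ℕ} (hk : k < d) {T : NES d} (hT : ∀ i ∈ T.1, k ≤ c i)
    (hcard : T.1.card + k = d) (i : Fin d) : w T i = u k i ^ 2 := by
  obtain ⟨h1, h2⟩ := hy T
  have hy0 : ∀ i, i ∉ T.1 → y T i = 0 := by
    intro i hi
    have := hw.1 T i hi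
    rw [h2] at this
    simpa using this
  have h3 : ∀ l < d, l ≠ k → ∑ i, u l i * y T i = 0 := by
    intro l hl hlk
    rcases lt_or_gt_of_ne hlk with hlt | hgt
    · refine Finset.sum_eq_zero fun i _ => ?_
      by_cases hi : i ∈ T.1
      · rw [(hc i).2.2 l (hlt.trans_le (hT i hi)), zero_mul]
      · rw [hy0 i hi, mul_zero]
    · exact h1 l hl (by omega)
  set ρ := ∑ j, u k j * y T j with hρ
  have h4 : ∀ i, y T i = u k i * ρ := by
    intro i
    calc y T i = ∑ j, (∑ l ∈ Finset.range d, u l i * u l j) * y T j := by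
          simp [h.col]
      _ = ∑ l ∈ Finset.range d, u l i * ∑ j, u l j * y T j := by
          simp_rw [Finset.sum_mul, Finset.mul_sum]
          rw [Finset.sum_comm]
          simp_rw [mul_assoc]
      _ = u k i * ρ := by
          rw [Finset.sum_eq_single k]
          · intro l hl hlk
            rw [h3 l (Finset.mem_range.1 hl) hlk, mul_zero]
          · simp [hk]
  have h5 : ∑ i, w T i = 1 := by
    rw [← hw.2.2.1 T]
    exact (Finset.sum_subset (Finset.subset_univ _) fun i _ hi => hw.1 T i hi).symm
  have h6 : ∑ i, w T i = ρ ^ 2 := by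
    have hrow := h.row k hk k hk
    rw [if_pos rfl] at hrow
    rw [← mul_one (ρ ^ 2), ← hrow, Finset.mul_sum]
    refine Finset.sum_congr rfl fun i _ => ?_
    rw [h2, h4]
    ring
  rw [h2, h4, mul_pow, ← h6, h5, mul_one]

lemma linked_rank (hlam : Function.Injective lam) (h : EigenRows d lam a β u)
    (hc : FirstRow u c) {y w : Ew d} (hw : w ∈ Bset lam) (hy : Linked u y w) :
    SuppRank w c ∧ ∀ n i, w (rankUpper c n) i = u (c n) i ^ 2 := by
  obtain ⟨o, ho, hs⟩ := Bset.exists_rank hlam hw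
  have hr := h.isRank hlam hc
  have key : ∀ k, ∀ i, o i < k ↔ c i < k := by
    intro k
    induction k with
    | zero => simp
    | succ k ih =>
      have hset : (Finset.univ.filter fun i => o i < k) = Finset.univ.filter fun i => c i < k := by
        ext i
        simp [ih i]
      suffices h1 : ∀ i, o i = k ↔ c i = k by
        intro i
        rw [Nat.lt_succ_iff_lt_or_eq, Nat.lt_succ_iff_lt_or_eq, ih i, h1 i]
      by_cases hex : ∃ n, o n = k ∨ c n = k
      · obtain ⟨n, hn⟩ := hex
        have hcard : (Finset.univ.filter fun i => c i < k).card = k := by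
          rcases hn with hn | hn
          · rw [← hset, ← hn, ← ho n]
          · rw [← hn, ← hr n]
        have hnk : k ≤ c n := by
          have := ih n
          omega
        let T : NES d := ⟨Finset.univ.filter fun i => k ≤ c i, n, by simpa using hnk⟩
        have hmem : ∀ i, i ∈ T.1 ↔ k ≤ c i := by simp [T]
        have hmem' : ∀ i, i ∈ T.1 ↔ k ≤ o i := by
          intro i
          rw [hmem, ← not_lt, ← not_lt, ih i]
        have hTcard : T.1.card + k = d := by
          have h2 := Finset.card_filter_add_card_filter_not (s := (Finset.univ : Finset (Fin d)))
            (fun m => c m < k)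
          rw [hcard, Finset.card_univ, Fintype.card_fin, add_comm] at h2
          convert h2 using 3
          ext i
          simp [hmem]
        have hkd : k < d := hnk.trans_lt (hc n).1
        have hval := h.linked_eq hc hw hy hkd (T := T) (fun i hi => (hmem i).1 hi) hTcard
        have hiff : ∀ i ∈ T.1, c i = k ↔ ∀ m ∈ T.1, o i ≤ o m := by
          intro i hi
          have h2 := hs T i
          rw [hval i, and_iff_right hi] at h2
          rw [← h2]
          constructor
          · rintro rfl
            exact pow_ne_zero 2 (hc i).2.1
          · intro hne
            by_contra hck
            have hik := (hmem i).1 hi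
            rw [(hc i).2.2 k (by omega)] at hne
            simp at hne
        have hmin : ∀ i ∈ T.1, (∀ m ∈ T.1, o i ≤ o m) → o i = k := by
          intro i hi hm
          rw [ho i, ← hcard, ← hset]
          congr 1
          ext m
          simp only [Finset.mem_filter, Finset.mem_univ, true_and]
          have hik := (hmem' i).1 hi
          constructor
          · intro h3
            by_contra h4
            have := hm m ((hmem' m).2 (not_lt.1 h4))
            omega
          · omega
        intro i
        constructor
        · intro hi
          refine (hiff i ((hmem' i).2 hi.ge)).2 fun m hm => ?_
          rw [hi]
          exact (hmem' m).1 hm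
        · intro hi
          have hiT := (hmem i).2 hi.ge
          exact hmin i hiT ((hiff i hiT).1 hi)
      · push Not at hex
        intro i
        simp [(hex i).1, (hex i).2]
  have hoc : o = c := by
    funext i
    have h1 := key (o i + 1) i
    have h2 := key (c i + 1) i
    omega
  subst hoc
  refine ⟨hs, fun n => h.linked_eq hc hw hy (hc n).1 (T := rankUpper o n)
    (fun i hi => by simpa [rankUpper] using hi) (hr.card_rankUpper n)⟩

/-- Membership in the span of the first rows, up to row `k`. -/
lemma shift_prod (h : EigenRows d lam a β u) {x : Fin d → ℝ} {k : ℕ}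
    (hx : ∀ l < d, k < l → ∑ i, u l i * x i = 0) (A : Finset (Fin d)) :
    ∀ l < d, k + A.card < l → ∑ i, u l i * ((∏ t ∈ A, (lam i - lam t)) * x i) = 0 := by
  classical
  induction A using Finset.induction_on with
  | empty => simpa using hx
  | insert t A ht ih =>
    intro l hl hkl
    rw [Finset.card_insert_of_notMem ht] at hkl
    set z : Fin d → ℝ := fun i => (∏ t ∈ A, (lam i - lam t)) * x i
    have h1 : ∀ i, u l i * ((∏ t ∈ insert t A, (lam i - lam t)) * x i)
        = β l * (u (l - 1) i * z i) + (a l - lam t) * (u l i * z i)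
          + β (l + 1) * (u (l + 1) i * z i) := by
      intro i
      rw [Finset.prod_insert ht]
      linear_combination z i * h.rec_eq l hl i
    simp_rw [h1, Finset.sum_add_distrib, ← Finset.mul_sum]
    rw [ih (l - 1) (by omega) (by omega), ih l hl (by omega)]
    rcases eq_or_lt_of_le (Nat.succ_le_of_lt hl) with h0 | h0
    · rw [show l + 1 = d from h0, h.last]
      ring
    · rw [ih (l + 1) h0 (by omega)]
      ring

lemma exists_linked (hlam : Function.Injective lam) (h : EigenRows d lam a β u) {o : Fin d → ℕ}
    (ho : IsRank o) {w : Ew d} (hw : w ∈ Bset lam) (hs : SuppRank w o) {z : Fin d → ℝ}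
    (hz : ∀ i, z i ^ 2 = w (rankUpper o i) i)
    (hu : ∀ n, ∀ l < d, o n < l → ∑ i, u l i * (if o i = o n then z i else 0) = 0) :
    ∃ y, Linked u y w := by
  classical
  have key : ∀ S : NES d, ∃ y : Fin d → ℝ,
      (∀ k < d, d < k + S.1.card → ∑ i, u k i * y i = 0) ∧ ∀ i, w S i = y i ^ 2 := by
    intro S
    obtain ⟨n, hn, hmin, hsub, h0⟩ := hs.exists_rankUpper hw S
    set D := ∑ j ∈ S.1, Cc lam j ((rankUpper o n).1 \ S.1) * w (rankUpper o n) j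
    have hD : 0 < D := Bset.sum_pos hlam hw hn h0
    refine ⟨fun i => (∏ t ∈ (rankUpper o n).1 \ S.1, (lam i - lam t)) *
      (if o i = o n then z i else 0) / √D, fun k hk hkS => ?_, fun i => ?_⟩
    · have h1 := h.shift_prod (hu n) ((rankUpper o n).1 \ S.1) k hk (by
        rw [Finset.card_sdiff_of_subset hsub]
        have := ho.card_rankUpper n
        have := Finset.card_le_card hsub
        omega)
      simp_rw [← mul_div_assoc]
      rw [← Finset.sum_div, h1, zero_div]
    · rw [div_pow, Real.sq_sqrt hD.le, eq_div_iff hD.ne']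
      by_cases hi : i ∈ S.1
      · rw [Bset.mul_sum_eq hw hsub hi, mul_pow, ← Finset.prod_pow]
        have h2 : ∏ t ∈ (rankUpper o n).1 \ S.1, (lam i - lam t) ^ 2
            = Cc lam i ((rankUpper o n).1 \ S.1) :=
          Finset.prod_congr rfl fun t _ => by ring
        rw [h2]
        congr 1
        split_ifs with h3
        · rw [hz i]
          congr 1
          apply Subtype.ext
          simp [rankUpper, h3]
        · rw [zero_pow two_ne_zero]
          by_contra h4
          exact h3 (le_antisymm (((hs _ _).1 h4).2 n (by simp [rankUpper])) (hmin i hi))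
      · rw [hw.1 S i hi, zero_mul]
        by_cases h3 : o i = o n
        · rw [Finset.prod_eq_zero (i := i) (by simp [rankUpper, h3, hi]) (sub_self _)]
          simp
        · simp [h3]
  choose y hy using key
  exact ⟨y, hy⟩

end EigenRows
/-- Tridiagonal matrices whose superdiagonal is nonnegative. -/
def IsTri {d : ℕ} (J : Matrix (Fin d) (Fin d) ℝ) : Prop :=
  (∀ i j : Fin d, (i : ℕ) + 2 ≤ (j : ℕ) ∨ (j : ℕ) + 2 ≤ (i : ℕ) → J i j = 0) ∧
    ∀ i j : Fin d, (i : ℕ) + 1 = (j : ℕ) → 0 ≤ J i j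

/-- The symmetric matrix with eigenvalues `lam` and orthonormal eigenvectors the columns
of `U`. -/
def conjDiag {d : ℕ} (lam : Fin d → ℝ) (U : Matrix (Fin d) (Fin d) ℝ) :
    Matrix (Fin d) (Fin d) ℝ :=
  U * Matrix.diagonal lam * U.transpose

/-- The rows of a square matrix, extended by zero to all natural numbers. -/
def rowsOf {d : ℕ} (U : Matrix (Fin d) (Fin d) ℝ) (k : ℕ) (i : Fin d) : ℝ :=
  if h : k < d then U ⟨k, h⟩ i else 0

/-- The diagonal of a square matrix, extended by zero to all natural numbers. -/
def diagOf {d : ℕ} (J : Matrix (Fin d) (Fin d) ℝ) (k : ℕ) : ℝ :=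
  if h : k < d then J ⟨k, h⟩ ⟨k, h⟩ else 0

/-- The superdiagonal of a square matrix, the entry in column `k` being given index `k`. -/
def offOf {d : ℕ} (J : Matrix (Fin d) (Fin d) ℝ) (k : ℕ) : ℝ :=
  if h : 1 ≤ k ∧ k < d then J ⟨k - 1, by omega⟩ ⟨k, h.2⟩ else 0

section conjDiag

variable {d : ℕ} {lam : Fin d → ℝ} {U : Matrix (Fin d) (Fin d) ℝ}

lemma conjDiag_apply (p q : Fin d) : conjDiag lam U p q = ∑ i, U p i * lam i * U q i := by
  simp [conjDiag, Matrix.mul_apply, Matrix.diagonal_apply]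

lemma conjDiag_symm (p q : Fin d) : conjDiag lam U p q = conjDiag lam U q p := by
  rw [conjDiag_apply, conjDiag_apply]
  exact Finset.sum_congr rfl fun i _ => by ring

lemma conjDiag_mem (hU : U * U.transpose = 1) (h : IsTri (conjDiag lam U)) :
    conjDiag lam U ∈ Jset lam := by
  refine ⟨conjDiag_symm, h.1, h.2, ?_⟩
  rw [conjDiag, Matrix.mul_assoc, Matrix.charpoly_mul_comm, Matrix.mul_assoc,
    mul_eq_one_comm.1 hU, Matrix.mul_one, Matrix.charpoly_diagonal]

lemma eigenRows_of (hU : U * U.transpose = 1) (h : IsTri (conjDiag lam U)) :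
    EigenRows d lam (diagOf (conjDiag lam U)) (offOf (conjDiag lam U)) (rowsOf U) where
  rec_eq k hk i := by
    set J := conjDiag lam U with hJ
    have h1 : J * U = U * Matrix.diagonal lam := by
      rw [hJ, conjDiag, Matrix.mul_assoc, mul_eq_one_comm.1 hU, Matrix.mul_one]
    have h2 := congrFun (congrFun h1 ⟨k, hk⟩) i
    rw [Matrix.mul_apply, Matrix.mul_diagonal] at h2
    have h3 : ∀ l : Fin d, J ⟨k, hk⟩ l * U l i
        = (if (l : ℕ) + 1 = k then offOf J k * rowsOf U (k - 1) i else 0)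
          + (if (l : ℕ) = k then diagOf J k * rowsOf U k i else 0)
          + (if (l : ℕ) = k + 1 then offOf J (k + 1) * rowsOf U (k + 1) i else 0) := by
      intro l
      rcases lt_trichotomy (l : ℕ) k with hl | hl | hl
      · by_cases hl' : (l : ℕ) + 1 = k
        · subst hl'
          rw [if_pos rfl, if_neg (by omega), if_neg (by omega)]
          simp [offOf, rowsOf, hk, hJ, conjDiag_symm]
        · rw [if_neg hl', if_neg (by omega), if_neg (by omega), h.1 _ _ (Or.inr (by simp; omega))]
          simp
      · subst hl
        rw [if_neg (by omega), if_pos rfl, if_neg (by omega)]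
        simp [diagOf, rowsOf]
      · by_cases hl' : (l : ℕ) = k + 1
        · rw [if_neg (by omega), if_neg (by omega), if_pos hl']
          have hk1 : k + 1 < d := hl' ▸ l.2
          have : l = ⟨k + 1, hk1⟩ := Fin.ext hl'
          subst this
          simp [offOf, rowsOf, hk1]
        · rw [if_neg (by omega), if_neg (by omega), if_neg hl',
            h.1 _ _ (Or.inl (by simp; omega))]
          simp
    have e0 : rowsOf U k i = U ⟨k, hk⟩ i := dif_pos hk
    rw [mul_comm, e0, ← h2, Finset.sum_congr rfl fun l _ => h3 l]
    rw [Fin.sum_univ_eq_sum_range (fun l : ℕ =>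
        (if l + 1 = k then offOf J k * rowsOf U (k - 1) i else 0)
          + (if l = k then diagOf J k * rowsOf U k i else 0)
          + (if l = k + 1 then offOf J (k + 1) * rowsOf U (k + 1) i else 0)) d,
      Finset.sum_add_distrib, Finset.sum_add_distrib, Finset.sum_ite_eq', Finset.sum_ite_eq',
      if_pos (Finset.mem_range.2 hk), e0]
    congr 1
    · congr 1
      cases k with
      | zero => simp [offOf]
      | succ k =>
        simp only [Nat.add_right_cancel_iff]
        rw [Finset.sum_ite_eq', if_pos (Finset.mem_range.2 (by omega))]
    · split_ifs with hd
      · rfl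
      · simp only [Finset.mem_range] at hd
        simp [offOf, hd]
  zero := by simp [offOf]
  last := by simp [offOf]
  nonneg k := by
    unfold offOf
    split_ifs with hk
    · exact h.2 _ _ (by simp; omega)
    · exact le_rfl
  row k hk l hl := by
    have h1 := congrFun (congrFun hU ⟨k, hk⟩) ⟨l, hl⟩
    simpa [Matrix.mul_apply, Matrix.one_apply, rowsOf, hk, hl] using h1
  col i j := by
    have hU' := mul_eq_one_comm.1 hU
    have h1 := congrFun (congrFun hU' i) j
    rw [← Fin.sum_univ_eq_sum_range (fun k => rowsOf U k i * rowsOf U k j) d]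
    simpa [Matrix.mul_apply, Matrix.one_apply, rowsOf] using h1

lemma exists_conjDiag (hlam : Function.Injective lam) {J : Matrix (Fin d) (Fin d) ℝ}
    (hJ : J ∈ Jset lam) : ∃ U : Matrix (Fin d) (Fin d) ℝ,
      U * U.transpose = 1 ∧ J = conjDiag lam U := by
  have h1 : ∀ i, ∃ v : Fin d → ℝ, v ⬝ᵥ v = 1 ∧ J.mulVec v = lam i • v := by
    intro i
    have hdet : (Matrix.scalar (Fin d) (lam i) - J).det = 0 := by
      rw [← Matrix.eval_charpoly, hJ.2.2.2, eval_prod]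
      exact Finset.prod_eq_zero (Finset.mem_univ i) (by simp)
    obtain ⟨v, hv, hv0⟩ := Matrix.exists_mulVec_eq_zero_iff.2 hdet
    have hpos : 0 < v ⬝ᵥ v := by
      refine lt_of_le_of_ne (Finset.sum_nonneg fun i _ => mul_self_nonneg _) fun h => hv ?_
      exact dotProduct_self_eq_zero.1 h.symm
    refine ⟨(√(v ⬝ᵥ v))⁻¹ • v, ?_, ?_⟩
    · rw [smul_dotProduct, dotProduct_smul, smul_smul, smul_eq_mul, ← mul_inv,
        Real.mul_self_sqrt hpos.le, inv_mul_cancel₀ hpos.ne']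
    · rw [Matrix.sub_mulVec, sub_eq_zero] at hv0
      rw [Matrix.mulVec_smul, ← hv0, smul_comm]
      congr 1
      ext j
      simp [Matrix.scalar_apply, Matrix.mulVec_diagonal]
  choose v hv hJv using h1
  have hort : ∀ i j, i ≠ j → v i ⬝ᵥ v j = 0 := by
    intro i j hij
    have hJt : J.transpose = J := by
      ext p q
      exact hJ.1 q p
    have e1 : J.mulVec (v i) ⬝ᵥ v j = v i ⬝ᵥ J.mulVec (v j) := by
      rw [Matrix.dotProduct_mulVec, ← Matrix.mulVec_transpose, hJt]
    rw [hJv, hJv, smul_dotProduct, dotProduct_smul, smul_eq_mul, smul_eq_mul, ← sub_eq_zero,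
      ← sub_mul] at e1
    exact (mul_eq_zero.1 e1).resolve_left (sub_ne_zero.2 fun e => hij (hlam e))
  have hU : (Matrix.of fun k i => v i k : Matrix (Fin d) (Fin d) ℝ).transpose *
      Matrix.of (fun k i => v i k) = 1 := by
    ext i j
    rw [Matrix.one_apply]
    change v i ⬝ᵥ v j = _
    split_ifs with h
    · rw [h, hv]
    · exact hort i j h
  refine ⟨Matrix.of fun k i => v i k, mul_eq_one_comm.1 hU, ?_⟩
  have hJU : J * (Matrix.of fun k i => v i k)
      = (Matrix.of fun k i => v i k) * Matrix.diagonal lam := by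
    ext k i
    rw [Matrix.mul_diagonal]
    have := congrFun (hJv i) k
    simpa [Matrix.mul_apply, Matrix.mulVec, dotProduct, mul_comm] using this
  rw [conjDiag, ← hJU, Matrix.mul_assoc, mul_eq_one_comm.1 hU, Matrix.mul_one]

/-- The entries of the eigenvectors are unique up to sign. -/
lemma sq_eq_of_conjDiag_eq (hlam : Function.Injective lam) {V : Matrix (Fin d) (Fin d) ℝ}
    (hU : U * U.transpose = 1) (hV : V * V.transpose = 1)
    (h : conjDiag lam U = conjDiag lam V) (k : ℕ) (i : Fin d) :
    rowsOf U k i ^ 2 = rowsOf V k i ^ 2 := by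
  have hU' := mul_eq_one_comm.1 hU
  have hV' := mul_eq_one_comm.1 hV
  set D := U.transpose * V with hD
  have h1 : Matrix.diagonal lam * D = D * Matrix.diagonal lam := by
    have e1 : U.transpose * conjDiag lam U * V = Matrix.diagonal lam * D := by
      rw [conjDiag, hD]
      simp only [← Matrix.mul_assoc]
      rw [hU', Matrix.one_mul]
    have e2 : U.transpose * conjDiag lam V * V = D * Matrix.diagonal lam := by
      rw [conjDiag, hD]
      simp only [Matrix.mul_assoc]
      rw [hV', Matrix.mul_one]
    rw [← e1, ← e2, h]
  have h2 : ∀ i j, i ≠ j → D i j = 0 := by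
    intro i j hij
    have e := congrFun (congrFun h1 i) j
    rw [Matrix.diagonal_mul, Matrix.mul_diagonal, mul_comm, ← sub_eq_zero, ← mul_sub] at e
    exact (mul_eq_zero.1 e).resolve_right (sub_ne_zero.2 fun e => hij (hlam e))
  have h3 : D.transpose * D = 1 := by
    rw [hD, Matrix.transpose_mul, Matrix.transpose_transpose, Matrix.mul_assoc,
      ← Matrix.mul_assoc U, hU, Matrix.one_mul, hV']
  have h4 : D i i ^ 2 = 1 := by
    have e := congrFun (congrFun h3 i) i
    rw [Matrix.mul_apply, Matrix.one_apply_eq, Finset.sum_eq_single i (fun j _ hj => by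
      rw [h2 j i hj, mul_zero]) (by simp)] at e
    rw [sq]
    exact e
  have h5 : U * D = V := by
    rw [hD, ← Matrix.mul_assoc, hU, Matrix.one_mul]
  unfold rowsOf
  split_ifs with hk
  · rw [← h5, Matrix.mul_apply, Finset.sum_eq_single i (fun j _ hj => by
      rw [h2 j i hj, mul_zero]) (by simp), mul_pow, h4, mul_one]
  · rfl

end conjDiag

section Tridiagonal

open InnerProductSpace

variable {d : ℕ} {E : Type*} [NormedAddCommGroup E] [InnerProductSpace ℝ E] {f : Fin d → E}

lemma inner_gramSchmidtNormed_of_mem_span {p : Fin d} {x : E}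
    (hx : x ∈ Submodule.span ℝ (f '' Set.Iio p)) :
    inner ℝ (gramSchmidtNormed ℝ f p) x = 0 := by
  induction hx using Submodule.span_induction with
  | mem x hx =>
    obtain ⟨m, hm, rfl⟩ := hx
    rw [gramSchmidtNormed, real_inner_smul_left, gramSchmidt_inv_triangular ℝ f hm, mul_zero]
  | zero => rw [inner_zero_right]
  | add x y _ _ hx hy => rw [inner_add_right, hx, hy, add_zero]
  | smul r x _ hx => rw [real_inner_smul_right, hx, mul_zero]

lemma exists_gramSchmidtNormed_eq (f : Fin d → E) (p : Fin d) : ∃ r : ℝ, 0 ≤ r ∧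
    ∃ s ∈ Submodule.span ℝ (f '' Set.Iio p), gramSchmidtNormed ℝ f p = r • f p - s := by
  refine ⟨‖gramSchmidt ℝ f p‖⁻¹, by positivity, ‖gramSchmidt ℝ f p‖⁻¹ •
    ∑ i ∈ Finset.Iio p, (Submodule.span ℝ {gramSchmidt ℝ f i}).starProjection (f p), ?_, ?_⟩
  · refine Submodule.smul_mem _ _ (Submodule.sum_mem _ fun i hi => ?_)
    rw [← span_gramSchmidt_Iio]
    refine Submodule.span_mono ?_ (Submodule.starProjection_apply_mem _ _)
    rw [Set.singleton_subset_iff]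
    exact ⟨i, Finset.mem_Iio.1 hi, rfl⟩
  · rw [← smul_sub, ← gramSchmidt_def]
    rfl

/-- Gram–Schmidt orthonormalization makes an operator upper Hessenberg if the operator
acts on the given vectors by shifts and scalars. -/
lemma inner_gramSchmidtNormed_hessenberg (hf : LinearIndependent ℝ f) {T : E →ₗ[ℝ] E}
    {μ : Fin d → ℝ} (hTf : ∀ m, T (f m) = μ m • f m ∨
      ∃ k : Fin d, (k : ℕ) = m + 1 ∧ T (f m) = μ m • f m + f k) :
    (∀ p q : Fin d, (q : ℕ) + 2 ≤ p →
      inner ℝ (gramSchmidtNormed ℝ f p) (T (gramSchmidtNormed ℝ f q)) = 0) ∧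
    ∀ p q : Fin d, (q : ℕ) + 1 = p →
      0 ≤ inner ℝ (gramSchmidtNormed ℝ f p) (T (gramSchmidtNormed ℝ f q)) := by
  have hspan : ∀ q p : Fin d, (q : ℕ) + 1 ≤ p → ∀ s ∈ Submodule.span ℝ (f '' Set.Iio q),
      T s ∈ Submodule.span ℝ (f '' Set.Iio p) := by
    intro q p hqp s hs
    induction hs using Submodule.span_induction with
    | mem x hx =>
      obtain ⟨m, hm, rfl⟩ := hx
      have hm : (m : ℕ) < q := hm
      have hmp : f m ∈ Submodule.span ℝ (f '' Set.Iio p) :=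
        Submodule.subset_span ⟨m, Fin.lt_def.2 (by omega), rfl⟩
      rcases hTf m with h | ⟨k, hk, h⟩ <;> rw [h]
      · exact Submodule.smul_mem _ _ hmp
      · exact Submodule.add_mem _ (Submodule.smul_mem _ _ hmp)
          (Submodule.subset_span ⟨k, Fin.lt_def.2 (by omega), rfl⟩)
    | zero => rw [map_zero]; exact Submodule.zero_mem _
    | add x y _ _ hx hy => rw [map_add]; exact Submodule.add_mem _ hx hy
    | smul r x _ hx => rw [map_smul]; exact Submodule.smul_mem _ _ hx
  have key : ∀ p q : Fin d, (q : ℕ) + 1 ≤ p → ∃ r : ℝ, 0 ≤ r ∧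
      inner ℝ (gramSchmidtNormed ℝ f p) (T (gramSchmidtNormed ℝ f q))
        = r * inner ℝ (gramSchmidtNormed ℝ f p) (T (f q)) := by
    intro p q hqp
    obtain ⟨r, hr, s, hs, e⟩ := exists_gramSchmidtNormed_eq f q
    refine ⟨r, hr, ?_⟩
    rw [e, map_sub, map_smul, inner_sub_right, real_inner_smul_right,
      inner_gramSchmidtNormed_of_mem_span (hspan q p hqp s hs), sub_zero]
  have hlow : ∀ p q : Fin d, q < p → inner ℝ (gramSchmidtNormed ℝ f p) (f q) = 0 := fun p q h =>
    inner_gramSchmidtNormed_of_mem_span (Submodule.subset_span ⟨q, h, rfl⟩)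
  constructor
  · intro p q hqp
    obtain ⟨r, -, e⟩ := key p q (by omega)
    rw [e]
    rcases hTf q with h | ⟨k, hk, h⟩ <;> rw [h]
    · rw [real_inner_smul_right, hlow p q (Fin.lt_def.2 (by omega)), mul_zero, mul_zero]
    · rw [inner_add_right, real_inner_smul_right, hlow p q (Fin.lt_def.2 (by omega)),
        hlow p k (Fin.lt_def.2 (by omega)), mul_zero, add_zero, mul_zero]
  · intro p q hqp
    obtain ⟨r, hr, e⟩ := key p q (by omega)
    rw [e]
    rcases hTf q with h | ⟨k, hk, h⟩ <;> rw [h]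
    · rw [real_inner_smul_right, hlow p q (Fin.lt_def.2 (by omega)), mul_zero, mul_zero]
    · obtain rfl : k = p := Fin.ext (by omega)
      rw [inner_add_right, real_inner_smul_right, hlow k q (Fin.lt_def.2 (by omega)), mul_zero,
        zero_add]
      refine mul_nonneg hr ?_
      obtain ⟨t, ht, s, hs, e'⟩ := exists_gramSchmidtNormed_eq f k
      have h1 := congrArg (inner ℝ (gramSchmidtNormed ℝ f k)) e'
      rw [inner_sub_right, real_inner_smul_right, inner_gramSchmidtNormed_of_mem_span hs,
        sub_zero] at h1
      have h2 : inner ℝ (gramSchmidtNormed ℝ f k) (gramSchmidtNormed ℝ f k) = 1 := by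
        rw [real_inner_self_eq_norm_sq, gramSchmidtNormed_unit_length k hf, one_pow]
      rw [h2] at h1
      by_contra! h3
      nlinarith [mul_nonpos_of_nonneg_of_nonpos ht h3.le]

/-- Every rank function with positive weights comes from the eigenvectors of a tridiagonal
matrix. -/
lemma exists_isTri {lam : Fin d → ℝ} (hlam : Function.Injective lam) {o : Fin d → ℕ}
    (ho : IsRank o) {z : Fin d → ℝ} (hz : ∀ i, 0 < z i) :
    ∃ U : Matrix (Fin d) (Fin d) ℝ, U * U.transpose = 1 ∧ IsTri (conjDiag lam U) ∧
      ∀ n, ∀ l < d, o n < l → ∑ i, rowsOf U l i * (if o i = o n then z i else 0) = 0 := by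
  classical
  have hmono : Monotone (o ∘ Tuple.sort o) := Tuple.monotone_sort o
  have hsort_le := ho.sort_le
  have hlt_sort := ho.lt_sort
  set σ := Tuple.sort o
  let A : Fin d → Finset (Fin d) := fun k =>
    Finset.univ.filter fun l => l < k ∧ o (σ l) = o (σ k)
  let f : Fin d → EuclideanSpace ℝ (Fin d) := fun k => WithLp.toLp 2 fun i =>
    if o i = o (σ k) then (∏ l ∈ A k, (lam i - lam (σ l))) * z i else 0
  have hf : ∀ k i, f k i
      = if o i = o (σ k) then (∏ l ∈ A k, (lam i - lam (σ l))) * z i else 0 := fun _ _ => rfl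
  have hzero : ∀ m k, k < m → f m (σ k) = 0 := by
    intro m k hkm
    rw [hf]
    split_ifs with h
    · rw [Finset.prod_eq_zero (i := k) (by simp [A, hkm, h]) (sub_self _), zero_mul]
    · rfl
  have hne : ∀ k, f k (σ k) ≠ 0 := by
    intro k
    rw [hf, if_pos rfl]
    refine mul_ne_zero (Finset.prod_ne_zero_iff.2 fun l hl => sub_ne_zero.2 fun e => ?_) (hz _).ne'
    have hl : l < k := (Finset.mem_filter.1 hl).2.1
    exact hl.ne' (σ.injective (hlam e))
  have hli : LinearIndependent ℝ f := by
    rw [Fintype.linearIndependent_iff]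
    intro g hg k
    induction k using WellFoundedLT.induction with
    | _ k ih =>
      have h1 := congrArg (fun x : EuclideanSpace ℝ (Fin d) => x (σ k)) hg
      simp only [WithLp.ofLp_sum, Finset.sum_apply, PiLp.smul_apply, smul_eq_mul,
        PiLp.zero_apply] at h1
      rw [Finset.sum_eq_single k _ (by simp)] at h1
      · exact (mul_eq_zero.1 h1).resolve_right (hne k)
      · intro m _ hm
        rcases lt_or_gt_of_ne hm with h | h
        · rw [ih m h, zero_mul]
        · rw [hzero m k h, mul_zero]
  let T : EuclideanSpace ℝ (Fin d) →ₗ[ℝ] EuclideanSpace ℝ (Fin d) :=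
    { toFun := fun x => WithLp.toLp 2 fun i => lam i * x i
      map_add' := fun x y => by ext i; simp [mul_add]
      map_smul' := fun r x => by ext i; simp [mul_left_comm] }
  have hT : ∀ x i, T x i = lam i * x i := fun _ _ => rfl
  have hTf : ∀ m, T (f m) = lam (σ m) • f m ∨
      ∃ k : Fin d, (k : ℕ) = m + 1 ∧ T (f m) = lam (σ m) • f m + f k := by
    intro m
    by_cases h : ∃ k : Fin d, (k : ℕ) = m + 1 ∧ o (σ k) = o (σ m)
    · obtain ⟨k, hk, hkm⟩ := h
      refine Or.inr ⟨k, hk, ?_⟩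
      have hA : A k = insert m (A m) := by
        ext l
        simp only [A, Finset.mem_filter, Finset.mem_univ, true_and, Finset.mem_insert, hkm,
          Fin.lt_def, Fin.ext_iff]
        constructor
        · rintro ⟨h1, h2⟩
          by_cases h3 : (l : ℕ) = m
          · exact Or.inl h3
          · exact Or.inr ⟨by omega, h2⟩
        · rintro (h1 | ⟨h1, h2⟩)
          · obtain rfl : l = m := Fin.ext h1
            exact ⟨by omega, rfl⟩
          · exact ⟨by omega, h2⟩
      ext i
      simp only [PiLp.add_apply, PiLp.smul_apply, smul_eq_mul, hT, hf, hkm, hA]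
      rw [Finset.prod_insert (by simp [A])]
      split_ifs <;> ring
    · refine Or.inl ?_
      ext i
      simp only [PiLp.smul_apply, smul_eq_mul, hT, hf]
      split_ifs with hi
      · obtain ⟨l, rfl⟩ := σ.surjective i
        rcases lt_trichotomy l m with hl | rfl | hl
        · rw [Finset.prod_eq_zero (i := l) (by simp [A, hl, hi]) (sub_self _)]
          ring
        · rfl
        · refine absurd ⟨⟨m + 1, by have := Fin.lt_def.1 hl; omega⟩, rfl, ?_⟩ h
          refine le_antisymm ?_ (hmono (Fin.le_def.2 (by simp)))
          rw [← hi]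
          exact hmono (Fin.le_def.2 (by simpa using Fin.lt_def.1 hl))
      · ring
  set e := gramSchmidtNormed ℝ f with he
  have hort := gramSchmidtNormed_orthonormal hli
  have hinner : ∀ x y : EuclideanSpace ℝ (Fin d), inner ℝ x y = ∑ i, x i * y i := by
    intro x y
    simp [PiLp.inner_apply, mul_comm]
  obtain ⟨h1, h2⟩ := inner_gramSchmidtNormed_hessenberg hli hTf
  rw [← he] at h1 h2
  have hconj : ∀ p q, conjDiag lam (Matrix.of fun p i => e p i) p q = inner ℝ (e p) (T (e q)) := by
    intro p q
    rw [conjDiag_apply, hinner]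
    simp only [hT, Matrix.of_apply, mul_assoc]
  refine ⟨Matrix.of fun p i => e p i, ?_, ⟨?_, ?_⟩, ?_⟩
  · ext p q
    rw [Matrix.mul_apply]
    have := orthonormal_iff_ite.1 hort p q
    rw [hinner] at this
    rw [Matrix.one_apply, ← this]
    rfl
  · rintro p q (h | h)
    · rw [conjDiag_symm, hconj, h1 q p h]
    · rw [hconj, h1 p q h]
  · intro p q h
    rw [conjDiag_symm, hconj]
    exact h2 q p h
  · intro n l hl hnl
    have hn : o n < d := by omega
    have hb : o (σ ⟨o n, hn⟩) = o n := by
      have h3 := hsort_le ⟨o n, hn⟩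
      have h4 := hlt_sort ⟨o n, hn⟩
      refine le_antisymm h3 ?_
      by_contra! h5
      exact absurd (ho.card_le_le h5) (not_le.2 h4)
    have hfn : ∀ i, f ⟨o n, hn⟩ i = if o i = o n then z i else 0 := by
      intro i
      rw [hf, hb]
      have : A ⟨o n, hn⟩ = ∅ := by
        refine Finset.filter_eq_empty_iff.2 fun l _ ⟨h3, h4⟩ => ?_
        have h5 := hsort_le l
        rw [h4, hb] at h5
        exact absurd h3 (not_lt.2 (Fin.le_def.2 h5))
      rw [this, Finset.prod_empty, one_mul]
    have h3 : inner ℝ (e ⟨l, hl⟩) (f ⟨o n, hn⟩) = 0 :=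
      inner_gramSchmidtNormed_of_mem_span (Submodule.subset_span
        ⟨⟨o n, hn⟩, Fin.lt_def.2 hnl, rfl⟩)
    rw [hinner] at h3
    refine Eq.trans (Finset.sum_congr rfl fun i _ => ?_) h3
    rw [hfn, rowsOf, dif_pos hl]
    rfl

end Tridiagonal

/-- The block-diagonal formula for the tridiagonal matrix linked to a point of `B`. -/
lemma conjDiag_eq_blockDiag {d : ℕ} {lam : Fin d → ℝ} (hlam : Function.Injective lam)
    {U : Matrix (Fin d) (Fin d) ℝ} (hU : U * U.transpose = 1) (htri : IsTri (conjDiag lam U))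
    {w y : Ew d} (hw : w ∈ Bset lam) (hy : Linked (rowsOf U) y w) :
    ∃ (r : ℕ) (S : Fin r → Finset (Fin d)), OrdPart S ∧
      (∀ j : Fin r, ∀ n ∈ S j, ∀ hK : (Kof S j).Nonempty,
        w ⟨Kof S j, hK⟩ n ≠ 0 ∧ ∀ T : NES d, w T n ≠ 0 → T.1.card ≤ (Kof S j).card) ∧
      conjDiag lam U = blockDiag lam S (fun j i =>
        if hK : (Kof S j).Nonempty then
          (if i ∈ S j then w ⟨Kof S j, hK⟩ i / ∑ m ∈ S j, w ⟨Kof S j, hK⟩ m else 0)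
        else 0) := by
  classical
  have h := eigenRows_of hU htri
  obtain ⟨c, hc⟩ := h.exists_firstRow
  have hr := h.isRank hlam hc
  obtain ⟨hs, hval⟩ := h.linked_rank hlam hc hw hy
  let I := Finset.univ.image c
  let e := I.orderEmbOfFin rfl
  let S : Fin I.card → Finset (Fin d) := fun j => Finset.univ.filter fun n => c n = e j
  have memS : ∀ j n, n ∈ S j ↔ c n = e j := by simp [S]
  have hcover : ∀ n, ∃ j, c n = e j := by
    intro n
    have h1 : c n ∈ Set.range e := by
      rw [Finset.range_orderEmbOfFin]
      simp [I]
    obtain ⟨j, hj⟩ := h1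
    exact ⟨j, hj.symm⟩
  have hrep : ∀ j, ∃ n, c n = e j := by
    intro j
    have h1 : e j ∈ I := Finset.orderEmbOfFin_mem I rfl j
    simpa [I] using h1
  have hdisj : ∀ j k, j ≠ k → Disjoint (S j) (S k) := by
    intro j k hjk
    refine Finset.disjoint_left.2 fun n h1 h2 => hjk (e.injective ?_)
    rw [← (memS j n).1 h1, (memS k n).1 h2]
  have hKof : ∀ j n, c n = e j → Kof S j = (rankUpper c n).1 := by
    intro j n hn
    ext m
    simp only [Kof, rankUpper, Finset.mem_biUnion, Finset.mem_filter, Finset.mem_univ, true_and,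
      memS, hn]
    constructor
    · rintro ⟨k, hk, hm⟩
      rw [hm]
      exact e.monotone hk
    · intro hm
      obtain ⟨k, hk⟩ := hcover m
      refine ⟨k, ?_, hk⟩
      rw [hk] at hm
      exact e.le_iff_le.1 hm
  have hwK : ∀ j n, c n = e j → ∀ hK : (Kof S j).Nonempty,
      w ⟨Kof S j, hK⟩ = w (rankUpper c n) := fun j n hn hK =>
    congrArg w (Subtype.ext (hKof j n hn))
  have hoff : ∀ j, offS S j = e j := by
    intro j
    obtain ⟨n, hn⟩ := hrep j
    rw [offS, ← Finset.card_biUnion fun j _ k _ hjk => hdisj j k hjk, ← hn, hr n]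
    congr 1
    ext m
    simp only [Finset.mem_biUnion, Finset.mem_filter, Finset.mem_univ, true_and, memS, hn]
    constructor
    · rintro ⟨k, hk, hm⟩
      rw [hm]
      exact e.strictMono hk
    · intro hm
      obtain ⟨k, hk⟩ := hcover m
      refine ⟨k, ?_, hk⟩
      rw [hk] at hm
      exact e.lt_iff_lt.1 hm
  have hS : ∀ j n, c n = e j → S j = Finset.univ.filter fun i => c i = c n := by
    intro j n hn
    ext m
    simp [memS, hn]
  refine ⟨I.card, S, ⟨?_, hdisj, ?_⟩, ?_, ?_⟩
  · intro j
    obtain ⟨n, hn⟩ := hrep j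
    exact ⟨n, (memS j n).2 hn⟩
  · ext n
    obtain ⟨j, hj⟩ := hcover n
    simpa using ⟨j, (memS j n).2 hj⟩
  · intro j n hn hK
    have hn := (memS j n).1 hn
    rw [hwK j n hn hK, hKof j n hn]
    constructor
    · rw [hs]
      simp [rankUpper]
    · intro T hT
      refine Finset.card_le_card fun m hm => ?_
      simpa [rankUpper] using ((hs T n).1 hT).2 m hm
  ext p q
  obtain ⟨j, hj⟩ := hcover (Tuple.sort c p)
  have hp1 := hr.sort_le p
  have hp2 := hr.lt_sort p
  set n := Tuple.sort c p
  have hjn := hS j n hj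
  set V : Fin I.card → Fin d → ℝ := fun j i =>
    if hK : (Kof S j).Nonempty then
      (if i ∈ S j then w ⟨Kof S j, hK⟩ i / ∑ m ∈ S j, w ⟨Kof S j, hK⟩ m else 0)
    else 0 with hV
  have hVj : ∀ i ∈ S j, V j i = rowsOf U (c n) i ^ 2 := by
    intro i hi
    have hK : (Kof S j).Nonempty := by
      rw [hKof j n hj]
      exact (rankUpper c n).2
    have hsum : ∑ m ∈ S j, rowsOf U (c n) m ^ 2 = 1 := by
      have h1 := h.row (c n) (hc n).1 (c n) (hc n).1
      rw [if_pos rfl] at h1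
      rw [← h1, Finset.sum_subset (Finset.subset_univ (S j)) fun m _ hm => ?_]
      · exact Finset.sum_congr rfl fun m _ => sq _
      · by_contra h2
        refine hm ((memS j m).2 ?_)
        rw [← hj]
        exact h.firstRow_eq hlam hc fun h3 => h2 (by rw [h3]; norm_num)
    simp only [hV]
    rw [dif_pos hK, if_pos hi, hwK j n hj hK]
    simp_rw [hval]
    rw [hsum, div_one]
  obtain ⟨hL1, hL2⟩ := h.lanczos hlam hc n hjn hVj
  rw [blockDiag, Matrix.of_apply, Finset.sum_eq_single j]
  · have hoj : offS S j = c n := (hoff j).trans hj.symm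
    rw [← hjn] at hp2
    split_ifs with hq <;> rw [hoj] at hq
    · simp only [Jmat, Matrix.of_apply, Fin.mk.injEq, hoj]
      split_ifs with h1 h2
      · rw [hL1 _ (by omega)]
        obtain rfl : p = q := Fin.ext (by omega)
        rw [Nat.add_sub_cancel' hp1, diagOf, dif_pos p.2]
      · rcases h2 with h2 | h2
        · rw [← h2, show ∀ a : ℕ, a + (a + 1) + 1 = 2 * (a + 1) by intro a; ring,
            hL2 _ (by omega), Nat.add_sub_cancel' hp1, offOf, dif_pos ⟨by omega, by omega⟩]
          congr 1
          exact Fin.ext (by simp; omega)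
        · rw [← h2, show ∀ a : ℕ, a + 1 + a + 1 = 2 * (a + 1) by intro a; ring,
            hL2 _ (by omega), Nat.add_sub_cancel' hq.2.2.1, offOf, dif_pos ⟨by omega, by omega⟩,
            conjDiag_symm]
          congr 1
          exact Fin.ext (by simp; omega)
      · exact htri.1 p q (by omega)
    · rw [conjDiag_apply]
      refine Finset.sum_eq_zero fun i _ => ?_
      by_contra h0
      have h1 : rowsOf U p i ≠ 0 := by
        rw [rowsOf, dif_pos p.2]
        exact fun h2 => h0 (by rw [h2]; ring)
      have h2 : rowsOf U q i ≠ 0 := by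
        rw [rowsOf, dif_pos q.2]
        exact fun h2 => h0 (by rw [h2]; ring)
      have hq1 := hr.sort_le q
      have hq2 := hr.lt_sort q
      have h3 := h.firstRow_eq_of_block hlam hc p.2 hp1 (hjn ▸ hp2) h1
      have h4 := h.firstRow_eq_of_block hlam hc q.2 hq1 hq2 h2
      rw [← h4, h3] at hq1 hq2
      rw [← hjn] at hq2
      exact hq ⟨hp1, hp2, hq1, hq2⟩
  · intro k _ hkj
    obtain ⟨m, hm⟩ := hrep k
    rw [dif_neg]
    rintro ⟨h1, h2, -⟩
    rw [hoff k, ← hm] at h1 h2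
    rw [hS k m hm] at h2
    rcases lt_trichotomy (c m) (c n) with h3 | h3 | h3
    · have := hr.card_le_le h3
      omega
    · exact hkj (e.injective (by rw [← hm, h3, hj]))
    · have := hr.card_le_le h3
      omega
  · simp

/-- Two continuous surjections from a compact space onto Hausdorff spaces with the same fibers
have homeomorphic images. -/
lemma exists_homeomorph_of_fibers {X Y Z : Type*} [TopologicalSpace X] [TopologicalSpace Y]
    [TopologicalSpace Z] [CompactSpace X] [T2Space Y] [T2Space Z] {F : X → Y} {G : X → Z}
    (hF : Continuous F) (hG : Continuous G) (sF : Function.Surjective F)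
    (sG : Function.Surjective G) (h : ∀ x x', F x = F x' ↔ G x = G x') :
    ∃ e : Y ≃ₜ Z, ∀ x, e (F x) = G x := by
  have h1 : ∀ x, G (Function.surjInv sF (F x)) = G x := fun x =>
    (h _ _).1 (Function.surjInv_eq sF _)
  have h2 : ∀ x, F (Function.surjInv sG (G x)) = F x := fun x =>
    (h _ _).2 (Function.surjInv_eq sG _)
  refine ⟨{ toFun := fun y => G (Function.surjInv sF y)
            invFun := fun z => F (Function.surjInv sG z)
            left_inv := fun y => ?_
            right_inv := fun z => ?_
            continuous_toFun := ?_
            continuous_invFun := ?_ }, h1⟩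
  · exact (h2 _).trans (Function.surjInv_eq sF y)
  · exact (h1 _).trans (Function.surjInv_eq sG z)
  · rw [(hF.isClosedMap.isQuotientMap hF sF).continuous_iff]
    exact hG.congr fun x => (h1 x).symm
  · rw [(hG.isClosedMap.isQuotientMap hG sG).continuous_iff]
    exact hF.congr fun x => (h2 x).symm

/-- Pairs of an orthogonal matrix of eigenvectors of a tridiagonal matrix and of signed square
roots of a point of `B` linked to it. -/
def linkedPairs {d : ℕ} (lam : Fin d → ℝ) : Set (Matrix (Fin d) (Fin d) ℝ × Ew d) :=
  {x | x.1 * x.1.transpose = 1 ∧ IsTri (conjDiag lam x.1) ∧ (fun S i => x.2 S i ^ 2) ∈ Bset lam ∧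
    Linked (rowsOf x.1) x.2 fun S i => x.2 S i ^ 2}

lemma isClosed_Bset {d : ℕ} (lam : Fin d → ℝ) : IsClosed (Bset lam) := by
  simp only [Bset, Set.ofPred_and, Set.ofPred_forall]
  refine .inter ?_ (.inter ?_ (.inter ?_ ?_))
  · exact isClosed_iInter fun S => isClosed_iInter fun n => isClosed_iInter fun _ =>
      isClosed_eq (by fun_prop) (by fun_prop)
  · exact isClosed_iInter fun S => isClosed_iInter fun n =>
      isClosed_le (by fun_prop) (by fun_prop)
  · exact isClosed_iInter fun S => isClosed_eq (by fun_prop) (by fun_prop)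
  · exact isClosed_iInter fun R => isClosed_iInter fun S => isClosed_iInter fun _ =>
      isClosed_iInter fun i => isClosed_iInter fun _ => isClosed_iInter fun j =>
      isClosed_iInter fun _ => isClosed_eq (by fun_prop) (by fun_prop)

lemma continuous_conjDiag {d : ℕ} (lam : Fin d → ℝ) : Continuous (conjDiag lam) :=
  (continuous_id.matrix_mul continuous_const).matrix_mul continuous_id.matrix_transpose

lemma continuous_rowsOf {d : ℕ} (k : ℕ) (i : Fin d) :
    Continuous fun U : Matrix (Fin d) (Fin d) ℝ => rowsOf U k i := by
  unfold rowsOf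
  split_ifs with h
  · exact continuous_id.matrix_elem _ _
  · exact continuous_const

lemma isClosed_linkedPairs {d : ℕ} (lam : Fin d → ℝ) : IsClosed (linkedPairs lam) := by
  have hJ : ∀ i j, Continuous fun x : Matrix (Fin d) (Fin d) ℝ × Ew d =>
      conjDiag lam x.1 i j := fun i j =>
    ((continuous_conjDiag lam).comp continuous_fst).matrix_elem i j
  have hR : ∀ k i, Continuous fun x : Matrix (Fin d) (Fin d) ℝ × Ew d => rowsOf x.1 k i :=
    fun k i => (continuous_rowsOf k i).comp continuous_fst
  have hsq : Continuous fun x : Matrix (Fin d) (Fin d) ℝ × Ew d =>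
      ((fun S i => x.2 S i ^ 2) : Ew d) := by fun_prop
  simp only [linkedPairs, IsTri, Linked, implies_true, and_true, Set.ofPred_and, Set.ofPred_forall]
  refine .inter ?_ (.inter (.inter ?_ ?_) (.inter ?_ ?_))
  · exact isClosed_eq (continuous_fst.matrix_mul continuous_fst.matrix_transpose) continuous_const
  · exact isClosed_iInter fun i => isClosed_iInter fun j => isClosed_iInter fun _ =>
      isClosed_eq (hJ i j) continuous_const
  · exact isClosed_iInter fun i => isClosed_iInter fun j => isClosed_iInter fun _ =>
      isClosed_le continuous_const (hJ i j)
  · exact (isClosed_Bset lam).preimage hsq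
  · refine isClosed_iInter fun S => isClosed_iInter fun k => isClosed_iInter fun _ =>
      isClosed_iInter fun _ => isClosed_eq ?_ continuous_const
    exact continuous_finsetSum _ fun i _ => (hR k i).mul (by fun_prop)

lemma isCompact_linkedPairs {d : ℕ} (lam : Fin d → ℝ) : IsCompact (linkedPairs lam) := by
  have h1 : IsCompact (Set.univ.pi fun _ : Fin d => Set.univ.pi fun _ : Fin d =>
      Set.Icc (-1 : ℝ) 1) :=
    isCompact_univ_pi fun _ => isCompact_univ_pi fun _ => isCompact_Icc
  have h2 : IsCompact (Set.univ.pi fun _ : NES d => Set.univ.pi fun _ : Fin d =>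
      Set.Icc (-1 : ℝ) 1) :=
    isCompact_univ_pi fun _ => isCompact_univ_pi fun _ => isCompact_Icc
  refine IsCompact.of_isClosed_subset (h1.prod h2) (isClosed_linkedPairs lam) ?_
  rintro ⟨U, y⟩ ⟨hU, -, hw, -⟩
  refine ⟨fun p _ i _ => ?_, fun S _ i _ => ?_⟩
  · have e := congrFun (congrFun hU p) p
    rw [Matrix.mul_apply, Matrix.one_apply_eq] at e
    have h3 := Finset.single_le_sum (f := fun i => U p i * U.transpose i p)
      (fun i _ => mul_self_nonneg (U p i)) (Finset.mem_univ i)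
    rw [e] at h3
    exact abs_le.1 (abs_le_one_iff_mul_self_le_one.2 h3)
  · refine abs_le.1 ((sq_le_one_iff_abs_le_one _).1 ?_)
    by_cases hi : i ∈ S.1
    · rw [← hw.2.2.1 S]
      exact Finset.single_le_sum (f := fun i => y S i ^ 2) (fun i _ => sq_nonneg _) hi
    · exact (hw.1 S i hi).trans_le zero_le_one

section linkedPairs

variable {d : ℕ} {lam : Fin d → ℝ}

lemma exists_linkedPairs_of_mem_Bset (hlam : Function.Injective lam) {w : Ew d}
    (hw : w ∈ Bset lam) : ∃ x ∈ linkedPairs lam, (fun S i => x.2 S i ^ 2) = w := by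
  obtain ⟨o, ho, hs⟩ := Bset.exists_rank hlam hw
  have hpos : ∀ i, 0 < w (rankUpper o i) i := fun i =>
    (hw.2.1 _ _).lt_of_ne' ((hs _ _).2 (by simp [rankUpper]))
  obtain ⟨U, hU, htri, hz⟩ := exists_isTri hlam ho fun i => Real.sqrt_pos.2 (hpos i)
  obtain ⟨y, hy⟩ := (eigenRows_of hU htri).exists_linked hlam ho hw hs
    (fun i => Real.sq_sqrt (hpos i).le) hz
  have hyw : (fun S i => y S i ^ 2) = w := by
    ext S i
    exact ((hy S).2 i).symm
  refine ⟨(U, y), ⟨hU, htri, ?_, ?_⟩, hyw⟩ <;> simp only [hyw] <;> assumption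

lemma exists_linkedPairs_of_mem_Jset (hlam : Function.Injective lam)
    {J : Matrix (Fin d) (Fin d) ℝ} (hJ : J ∈ Jset lam) :
    ∃ x ∈ linkedPairs lam, conjDiag lam x.1 = J := by
  obtain ⟨U, hU, rfl⟩ := exists_conjDiag hlam hJ
  have htri : IsTri (conjDiag lam U) := ⟨hJ.2.1, hJ.2.2.1⟩
  have h := eigenRows_of hU htri
  obtain ⟨c, hc⟩ := h.exists_firstRow
  have hsupp : ∀ n i, (if c i = c n then rowsOf U (c i) i else 0) = rowsOf U (c n) i := by
    intro n i
    split_ifs with hi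
    · rw [hi]
    · by_contra h0
      exact hi (h.firstRow_eq hlam hc (Ne.symm h0))
  have hsum : ∀ n, ∑ i, (if c i = c n then rowsOf U (c i) i ^ 2 else 0) = 1 := by
    intro n
    have h1 := h.row (c n) (hc n).1 (c n) (hc n).1
    rw [if_pos rfl] at h1
    rw [← h1]
    refine Finset.sum_congr rfl fun i _ => ?_
    rw [← hsupp n i]
    split_ifs <;> ring
  obtain ⟨w, hw, hs, hv⟩ := Bset.exists_of_rank hlam c (fun i => rowsOf U (c i) i ^ 2)
    (fun i => by have := (hc i).2.1; positivity) hsum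
  obtain ⟨y, hy⟩ := h.exists_linked hlam (h.isRank hlam hc) hw hs
    (z := fun i => rowsOf U (c i) i) (fun i => by rw [hv, if_pos rfl]) (by
      intro n l hl hnl
      simp_rw [hsupp]
      rw [h.row l hl (c n) (hc n).1, if_neg hnl.ne'])
  have hyw : (fun S i => y S i ^ 2) = w := by
    ext S i
    exact ((hy S).2 i).symm
  refine ⟨(U, y), ⟨hU, htri, ?_, ?_⟩, rfl⟩ <;> simp only [hyw] <;> assumption

lemma linkedPairs_sq_eq (hlam : Function.Injective lam)
    {x x' : Matrix (Fin d) (Fin d) ℝ × Ew d} (hx : x ∈ linkedPairs lam)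
    (hx' : x' ∈ linkedPairs lam) (h : conjDiag lam x.1 = conjDiag lam x'.1) :
    (fun S i => x.2 S i ^ 2 : Ew d) = fun S i => x'.2 S i ^ 2 := by
  obtain ⟨hU, ht, hw, hy⟩ := hx
  obtain ⟨hU', ht', hw', hy'⟩ := hx'
  have hsq := sq_eq_of_conjDiag_eq hlam hU hU' h
  have hE := eigenRows_of hU ht
  obtain ⟨c, hc⟩ := hE.exists_firstRow
  have hz : ∀ k i, rowsOf x'.1 k i = 0 ↔ rowsOf x.1 k i = 0 := by
    intro k i
    rw [← sq_eq_zero_iff, ← hsq, sq_eq_zero_iff]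
  have hc' : FirstRow (rowsOf x'.1) c := fun i =>
    ⟨(hc i).1, fun h => (hc i).2.1 ((hz _ _).1 h), fun l hl => (hz _ _).2 ((hc i).2.2 l hl)⟩
  obtain ⟨hs, hv⟩ := hE.linked_rank hlam hc hw hy
  obtain ⟨-, hv'⟩ := (eigenRows_of hU' ht').linked_rank hlam hc' hw' hy'
  refine Bset.ext_of_rank hlam hw hw' hs fun n => ?_
  ext i
  rw [hv, hv', hsq]

end linkedPairs

/-- the map `g : B → 𝒥̄^Λ` given by the block-diagonal formula is a
bijective homeomorphism. -/
theorem stmt1 {d : ℕ} (hd : 1 ≤ d) (lam : Fin d → ℝ) (hlam : Function.Injective lam)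
    (g : ↥(Bset lam) → Matrix (Fin d) (Fin d) ℝ)
    (hg : ∀ (w : Ew d) (hw : w ∈ Bset lam) (r : ℕ) (S : Fin r → Finset (Fin d)),
      OrdPart S →
      (∀ j : Fin r, ∀ n ∈ S j, ∀ hK : (Kof S j).Nonempty,
        w ⟨Kof S j, hK⟩ n ≠ 0 ∧ ∀ T : NES d, w T n ≠ 0 → T.1.card ≤ (Kof S j).card) →
      g ⟨w, hw⟩ = blockDiag lam S (fun j i =>
        if hK : (Kof S j).Nonempty then
          (if i ∈ S j then w ⟨Kof S j, hK⟩ i / ∑ m ∈ S j, w ⟨Kof S j, hK⟩ m else 0)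
        else 0)) :
    ∃ e : ↥(Bset lam) ≃ₜ ↥(Jset lam), ∀ w : ↥(Bset lam), (e w).1 = g w := by
  let F : linkedPairs lam → Bset lam := fun x => ⟨fun S i => x.1.2 S i ^ 2, x.2.2.2.1⟩
  let G : linkedPairs lam → Jset lam := fun x =>
    ⟨conjDiag lam x.1.1, conjDiag_mem x.2.1 x.2.2.1⟩
  have hgF : ∀ x, (G x).1 = g (F x) := by
    intro x
    obtain ⟨r, S, hS, hK, e⟩ := conjDiag_eq_blockDiag hlam x.2.1 x.2.2.1 x.2.2.2.1 x.2.2.2.2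
    rw [hg _ _ r S hS hK]
    exact e
  have sF : Function.Surjective F := by
    rintro ⟨w, hw⟩
    obtain ⟨x, hx, rfl⟩ := exists_linkedPairs_of_mem_Bset hlam hw
    exact ⟨⟨x, hx⟩, rfl⟩
  have sG : Function.Surjective G := by
    rintro ⟨J, hJ⟩
    obtain ⟨x, hx, rfl⟩ := exists_linkedPairs_of_mem_Jset hlam hJ
    exact ⟨⟨x, hx⟩, rfl⟩
  have hF : Continuous F := Continuous.subtype_mk (by fun_prop) _
  have hG : Continuous G := Continuous.subtype_mk
    ((continuous_conjDiag lam).comp (continuous_fst.comp continuous_subtype_val)) _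
  have : CompactSpace (linkedPairs lam) := isCompact_iff_compactSpace.1 (isCompact_linkedPairs lam)
  obtain ⟨e, he⟩ := exists_homeomorph_of_fibers hF hG sF sG fun x x' =>
    ⟨fun h => Subtype.ext (by rw [hgF, hgF, h]),
      fun h => Subtype.ext (linkedPairs_sq_eq hlam x.2 x'.2 (congrArg Subtype.val h))⟩
  refine ⟨e, fun w => ?_⟩
  obtain ⟨x, rfl⟩ := sF w
  rw [he, hgF]
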